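/- arXiv:2602.17878 — 8 statements merged into one kernel-verified Lean document; each statement's English description precedes it below -/
import Mathlib

section
/- In the FLOrA framework, let X_* be the (nonempty) set of minimizers of Φ and R_0 = min{‖x_0 − x‖ : x ∈ X_*}. Then for every k ≥ 0: (i) Φ(y_{k+1}) − Φ_* ≤ R_0²/(2B_{k+1}) + δ_0 C_F/B_{k+1}, where C_F = Σ_{i≥0} B_{i+1} α^i < ∞; and if moreover σ < 1, then (ii) ‖ỹ_{k+1} − x̃_k‖ ≤ (√λ R_0 + √(2λδ_0 C_F))/√((1−σ)B_{k+1}) and (iii) min_{0≤i≤k} ‖ỹ_{i+1} − x̃_i‖ ≤ (√λ R_0 + √(2λδ_0 C_F))/√((1−σ)Σ_{i=1}^{k+1} B_i). -/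
noncomputable section

open Set
open scoped RealInnerProductSpace BigOperators

/-- `n`-dimensional Euclidean space. -/
abbrev Euc (k : ℕ) : Type := EuclideanSpace ℝ (Fin k)

variable {n m : ℕ}

/-- `f` is `μ`-strongly convex on the set `s` (with `μ = 0` this is convexity on `s`). -/
def SCOn (s : Set (Euc n)) (mu : ℝ) (f : Euc n → ℝ) : Prop :=
  ∀ ⦃x⦄, x ∈ s → ∀ ⦃y⦄, y ∈ s → ∀ ⦃a c : ℝ⦄, 0 ≤ a → 0 ≤ c → a + c = 1 →
    f (a • x + c • y) ≤ a * f x + c * f y - mu / 2 * (a * c) * ‖x - y‖ ^ 2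

/-- The convex subdifferential of `f` at `x` relative to the domain `s`
(`f` is interpreted as `+∞` outside of `s`). -/
def subdiffOn (s : Set (Euc n)) (f : Euc n → ℝ) (x : Euc n) : Set (Euc n) :=
  {v | ∀ y ∈ s, f x + ⟪v, y - x⟫ ≤ f y}

/-- `p = prox_{η h}(x)`, where `h` is interpreted as `+∞` outside of `s`. -/
def IsProxPt (s : Set (Euc n)) (h : Euc n → ℝ) (eta : ℝ) (x p : Euc n) : Prop :=
  p ∈ s ∧ ∀ ⦃y⦄, y ∈ s → eta * h p + ‖p - x‖ ^ 2 / 2 ≤ eta * h y + ‖y - x‖ ^ 2 / 2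

/-- `f` is differentiable with gradient `f'`, and `f'` is `L`-Lipschitz (i.e. `f` is `L`-smooth). -/
def HasLipGrad (f : Euc n → ℝ) (f' : Euc n → Euc n) (L : ℝ) : Prop :=
  (∀ x, HasGradientAt f (f' x) x) ∧ ∀ x y, ‖f' x - f' y‖ ≤ L * ‖x - y‖

lemma aux_subgrad (s : Set (Euc n)) (hs : Convex ℝ s) (m c : ℝ) (G : Euc n → ℝ)
    (hG : SCOn s m G) (z xt : Euc n) (hz : z ∈ s)
    (hmin : ∀ w ∈ s, G z + c * ‖z - xt‖ ^ 2 / 2 ≤ G w + c * ‖w - xt‖ ^ 2 / 2)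
    (w : Euc n) (hw : w ∈ s) :
    G z + c * ⟪xt - z, w - z⟫ + m / 2 * ‖w - z‖ ^ 2 ≤ G w := by
  have key : ∀ t : ℝ, 0 < t → t < 1 →
      0 ≤ (G w - G z - m / 2 * ‖w - z‖ ^ 2 - c * ⟪xt - z, w - z⟫)
        + t * ((m / 2 + c / 2) * ‖w - z‖ ^ 2) := by
    intro t ht0 ht1
    have h1 := hG hz hw (a := 1 - t) (c := t) (by linarith) ht0.le (by ring)
    have h2 := hmin _ (hs hz hw (a := 1 - t) (b := t) (by linarith) ht0.le (by ring))
    have e : (1 - t) • z + t • w - xt = t • (w - z) - (xt - z) := by module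
    have e2 : ‖(1 - t) • z + t • w - xt‖ ^ 2
        = t ^ 2 * ‖w - z‖ ^ 2 - 2 * t * ⟪xt - z, w - z⟫ + ‖z - xt‖ ^ 2 := by
      rw [e, norm_sub_sq_real, norm_smul, inner_smul_left, real_inner_comm, norm_sub_rev xt z,
        mul_pow, Real.norm_eq_abs, sq_abs]
      simp; ring
    rw [e2] at h2
    rw [norm_sub_rev z w] at h1
    have : 0 ≤ t * ((G w - G z - m / 2 * ‖w - z‖ ^ 2 - c * ⟪xt - z, w - z⟫)
        + t * ((m / 2 + c / 2) * ‖w - z‖ ^ 2)) := by nlinarith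
    exact nonneg_of_mul_nonneg_right this ht0
  set K := G w - G z - m / 2 * ‖w - z‖ ^ 2 - c * ⟪xt - z, w - z⟫ with hK
  set M := (m / 2 + c / 2) * ‖w - z‖ ^ 2
  suffices h : 0 ≤ K by linarith
  by_contra hneg
  push Not at hneg
  have hp : 0 < |M| - K + 1 := by have := abs_nonneg M; linarith
  have ht : 0 < -K / (2 * (|M| - K + 1)) := by apply div_pos <;> linarith
  have ht1 : -K / (2 * (|M| - K + 1)) < 1 := by
    rw [div_lt_one (by linarith)]; have := abs_nonneg M; linarith
  have h := key _ ht ht1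
  have h3 : -K / (2 * (|M| - K + 1)) * M ≤ -K / 2 := by
    calc -K / (2 * (|M| - K + 1)) * M ≤ -K / (2 * (|M| - K + 1)) * (|M| - K + 1) := by
          apply mul_le_mul_of_nonneg_left _ ht.le
          have := le_abs_self M; linarith
      _ = -K / 2 := by field_simp
  linarith

lemma aux_A (w P z x u : Euc n) (b mu tau taup : ℝ) (htp : taup = tau + b * mu)
    (hP : taup • P = tau • x + (b * mu) • z - b • u) :
    b * (⟪u, w - z⟫ + mu / 2 * ‖w - z‖ ^ 2) + tau / 2 * ‖w - x‖ ^ 2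
      = b * (⟪u, P - z⟫ + mu / 2 * ‖P - z‖ ^ 2) + tau / 2 * ‖P - x‖ ^ 2
        + taup / 2 * ‖w - P‖ ^ 2 := by
  have h := congrArg (fun v => ⟪v, w - P⟫) hP
  subst htp
  simp only [← real_inner_self_eq_norm_sq, inner_sub_left, inner_sub_right, inner_add_left,
    real_inner_smul_left] at h ⊢
  rw [real_inner_comm w z, real_inner_comm w x, real_inner_comm P z, real_inner_comm P x,
    real_inner_comm w P] at *
  linarith

lemma aux_B (y P z x xt u uh : Euc n) (b B Bp mu tau lam : ℝ) (htau : 0 < tau) (hlam : 0 < lam)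
    (hmu : 0 ≤ mu) (hb : 0 ≤ b) (hB : 0 ≤ B) (hBp : Bp = B + b)
    (hbb : b ^ 2 = lam * tau * Bp) (hxt : Bp • xt = B • y + b • x)
    (hu : u = uh + lam⁻¹ • (xt - z)) :
    Bp * (‖z - xt‖ ^ 2 / (2 * lam) - lam / 2 * ‖uh‖ ^ 2) ≤
     B * (⟪u, y - z⟫ + mu / 2 * ‖y - z‖ ^ 2) + b * (⟪u, P - z⟫ + mu / 2 * ‖P - z‖ ^ 2)
      + tau / 2 * ‖P - x‖ ^ 2 := by
  have e1 : B * ⟪u, y - z⟫ + b * ⟪u, P - z⟫ = Bp * ⟪u, xt - z⟫ + b * ⟪u, P - x⟫ := by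
    have h := congrArg (fun v => ⟪u, v⟫) hxt
    simp only [inner_sub_right, inner_add_right, real_inner_smul_right] at h ⊢
    subst hBp; linarith
  have e2 : 0 ≤ b * ⟪u, P - x⟫ + tau / 2 * ‖P - x‖ ^ 2 + lam * Bp / 2 * ‖u‖ ^ 2 := by
    have h : 0 ≤ ‖b • u + tau • (P - x)‖ ^ 2 := by positivity
    rw [norm_add_sq_real, norm_smul, norm_smul, real_inner_smul_left, real_inner_smul_right,
      mul_pow, mul_pow, Real.norm_eq_abs, Real.norm_eq_abs, sq_abs, sq_abs, hbb] at h
    have : 0 ≤ tau * (b * ⟪u, P - x⟫ + tau / 2 * ‖P - x‖ ^ 2 + lam * Bp / 2 * ‖u‖ ^ 2) := by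
      linarith
    exact nonneg_of_mul_nonneg_right this htau
  have e3 : ⟪u, xt - z⟫ - lam / 2 * ‖u‖ ^ 2 = ‖z - xt‖ ^ 2 / (2 * lam) - lam / 2 * ‖uh‖ ^ 2 := by
    rw [hu, norm_add_sq_real, norm_smul, inner_add_left, real_inner_smul_left,
      real_inner_smul_right, real_inner_self_eq_norm_sq, mul_pow, Real.norm_eq_abs, sq_abs,
      norm_sub_rev z xt]
    field_simp; ring
  have p1 : 0 ≤ B * (mu / 2 * ‖y - z‖ ^ 2) := by positivity
  have p2 : 0 ≤ b * (mu / 2 * ‖P - z‖ ^ 2) := by positivity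
  rw [← e3]
  linarith

lemma aux_bound (b B tau : ℕ → ℝ) (lam mu : ℝ) (hlam : 0 < lam) (hmu : 0 ≤ mu)
    (hB0 : B 0 = 0) (hBn : ∀ k, 0 ≤ B k) (hbp : ∀ k, 0 < b k)
    (hBrec : ∀ k, B (k + 1) = B k + b k) (htau : ∀ k, tau k = 1 + mu * B k)
    (hbb : ∀ k, b k ^ 2 = lam * tau k * B (k + 1)) (k : ℕ) :
    √(B k) ≤ √lam * k * (1 + √(lam * mu)) ^ k := by
  induction k with
  | zero => simp [hB0]
  | succ k ih =>
    set r := 1 + √(lam * mu) with hr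
    have hr1 : 1 ≤ r := by have := Real.sqrt_nonneg (lam * mu); linarith
    have hstep : √(B (k + 1)) ≤ r * √(B k) + √lam := by
      have hS := Real.sqrt_nonneg (B k)
      have hBp : 0 < B (k + 1) := by have := hBn k; have := hbp k; rw [hBrec]; linarith
      have hSp := Real.sqrt_pos.2 hBp
      have q1 := Real.sq_sqrt (hBn k)
      have q2 := Real.sq_sqrt hBp.le
      have q3 := Real.sq_sqrt hlam.le
      have q4 := Real.sq_sqrt hmu
      rw [hr, Real.sqrt_mul hlam.le]
      have l0 := Real.sqrt_nonneg lam
      have m0 := Real.sqrt_nonneg mu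
      set S := √(B k)
      set T := √(B (k + 1))
      set l := √lam
      set m := √mu
      have hbT : b k ≤ l * (1 + m * S) * T := by
        apply (sq_le_sq₀ (hbp k).le (by positivity)).1
        rw [hbb, htau, ← q1, ← q2, ← q3, ← q4]
        have : 0 ≤ l ^ 2 * (m * S) * T ^ 2 := by positivity
        nlinarith
      have : b k = T ^ 2 - S ^ 2 := by rw [q1, q2, hBrec]; ring
      have h5 : T ^ 2 - S ^ 2 ≤ l * (1 + m * S) * T := by rw [← this]; exact hbT
      by_contra hc
      push Not at hc
      have h6 : l * (1 + m * S) < T - S := by linarith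
      have h7 := mul_lt_mul_of_pos_right h6 hSp
      have h8 : S ≤ T := by
        have : 0 ≤ l * (1 + m * S) := by positivity
        linarith
      nlinarith
    have h1 : 1 ≤ r ^ (k + 1) := one_le_pow₀ hr1
    calc √(B (k + 1)) ≤ r * √(B k) + √lam := hstep
      _ ≤ r * (√lam * k * r ^ k) + √lam * r ^ (k + 1) := by
          have := Real.sqrt_nonneg lam
          gcongr
          nlinarith
      _ = _ := by push_cast; ring

lemma aux_root (a d g L A : ℝ) (hL : 0 ≤ L) (ha : 0 < a) (hd : 0 ≤ d) (hA : 0 ≤ A) (hg : 0 ≤ g)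
    (h : a * d ^ 2 ≤ L * A ^ 2 + g) : d ≤ (√L * A + √g) / √a := by
  rw [le_div_iff₀ (Real.sqrt_pos.2 ha)]
  have q1 := Real.sq_sqrt hL
  have q2 := Real.sq_sqrt hg
  have q3 := Real.sq_sqrt ha.le
  have p1 := Real.sqrt_nonneg L
  have p2 := Real.sqrt_nonneg g
  have p3 := Real.sqrt_nonneg a
  apply (sq_le_sq₀ (by positivity) (by positivity)).1
  have : 0 ≤ √L * A * √g := by positivity
  rw [mul_pow, q3]
  nlinarith

/-!
STATEMENT 10 (Theorem: sub-optimality guarantees of the FLOrA framework).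
-/

theorem flora_complexity
    (domPhi : Set (Euc n)) (Phi : Euc n → ℝ) (Gam : ℕ → Euc n → ℝ)
    (sigma lam mu delta0 alpha : ℝ)
    (hsigma0 : 0 < sigma) (hsigma1 : sigma ≤ 1) (hlam : 0 < lam) (hmu : 0 ≤ mu)
    (hdelta0 : 0 ≤ delta0)
    (halpha0 : 0 ≤ alpha) (halpha1 : alpha < ((1 + Real.sqrt (lam * mu)) ^ 2)⁻¹)
    (hPhiconv : ConvexOn ℝ domPhi Phi)
    (hPhilsc : LowerSemicontinuousOn Phi domPhi)
    (hPhisc : SCOn domPhi mu Phi)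
    (b B tau : ℕ → ℝ) (x y xt yt z uhat u : ℕ → Euc n)
    (hB0 : B 0 = 0) (htau0 : tau 0 = 1) (hy0 : y 0 = x 0) (hx0 : x 0 ∈ domPhi)
    (hb : ∀ k, b k = (lam * tau k +
        Real.sqrt (lam ^ 2 * tau k ^ 2 + 4 * lam * tau k * B k)) / 2)
    (hBrec : ∀ k, B (k + 1) = B k + b k)
    (htaurec : ∀ k, tau (k + 1) = tau k + b k * mu)
    (hxt : ∀ k, xt k = (B k / B (k + 1)) • y k + (b k / B (k + 1)) • x k)
    (hGamsc : ∀ k, SCOn domPhi (mu + 1 / lam) (Gam k))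
    (hGamle : ∀ k, ∀ w ∈ domPhi, Gam k w ≤ Phi w + ‖w - xt k‖ ^ 2 / (2 * lam))
    (hytmem : ∀ k, yt (k + 1) ∈ domPhi) (hzmem : ∀ k, z (k + 1) ∈ domPhi)
    -- `z_{k+1}` and `û_{k+1}`: either `𝒜_k < ∞` or `𝒜_k = ∞`
    (hz : ∀ k, (∃ 𝒜 : ℝ, 0 < 𝒜 ∧
            (∀ w ∈ domPhi, Gam k (z (k + 1)) + ‖z (k + 1) - xt k‖ ^ 2 / (2 * 𝒜) ≤
              Gam k w + ‖w - xt k‖ ^ 2 / (2 * 𝒜)) ∧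
            uhat (k + 1) = 𝒜⁻¹ • (xt k - z (k + 1))) ∨
          ((∀ w ∈ domPhi, Gam k (z (k + 1)) ≤ Gam k w) ∧ uhat (k + 1) = 0))
    -- the FLOrA inexactness condition with `δ_k = δ_0 αᵏ`
    (hineq : ∀ k,
        ‖lam • uhat (k + 1)‖ ^ 2 +
          2 * lam * (Phi (yt (k + 1)) + ‖yt (k + 1) - xt k‖ ^ 2 / (2 * lam) -
            Gam k (z (k + 1))) ≤
        sigma * ‖yt (k + 1) - xt k‖ ^ 2 + 2 * lam * (delta0 * alpha ^ k))
    (hymem : ∀ k, y (k + 1) ∈ domPhi)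
    (hyle : ∀ k, Phi (y (k + 1)) ≤ Phi (yt (k + 1)))
    (hu : ∀ k, u (k + 1) = uhat (k + 1) + lam⁻¹ • (xt k - z (k + 1)))
    (hxrec : ∀ k, x (k + 1) = (tau (k + 1))⁻¹ •
        (tau k • x k + (b k * mu) • z (k + 1) - b k • u (k + 1)))
    -- `xstar` attains the minimum distance `R0` from `x 0` to the solution set
    (xstar : Euc n) (R0 : ℝ)
    (hxstar : xstar ∈ domPhi) (hxstarmin : ∀ w ∈ domPhi, Phi xstar ≤ Phi w)
    (hR0 : R0 = ‖x 0 - xstar‖)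
    (hR0min : ∀ w ∈ domPhi, (∀ v ∈ domPhi, Phi w ≤ Phi v) → R0 ≤ ‖x 0 - w‖) :
    Summable (fun i : ℕ => B (i + 1) * alpha ^ i) ∧
    ∀ k : ℕ,
      (Phi (y (k + 1)) - Phi xstar ≤ R0 ^ 2 / (2 * B (k + 1)) +
        delta0 * (∑' i : ℕ, B (i + 1) * alpha ^ i) / B (k + 1)) ∧
      (sigma < 1 →
        ‖yt (k + 1) - xt k‖ ≤
          (Real.sqrt lam * R0 +
            Real.sqrt (2 * lam * delta0 * ∑' i : ℕ, B (i + 1) * alpha ^ i)) /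
          Real.sqrt ((1 - sigma) * B (k + 1)) ∧
        ∃ i, i ≤ k ∧
          ‖yt (i + 1) - xt i‖ ≤
            (Real.sqrt lam * R0 +
              Real.sqrt (2 * lam * delta0 * ∑' i : ℕ, B (i + 1) * alpha ^ i)) /
            Real.sqrt ((1 - sigma) * ∑ j ∈ Finset.range (k + 1), B (j + 1))) := by
  have htau : ∀ k, tau k = 1 + mu * B k := by
    intro k
    induction k with
    | zero => simp [hB0, htau0]
    | succ k ih => rw [htaurec, hBrec, ih]; ring
  have hpos : ∀ k, 0 ≤ B k ∧ 0 < b k := by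
    have aux : ∀ k, 0 ≤ B k → 0 < b k := by
      intro k hk
      have : 0 < tau k := by rw [htau]; positivity
      rw [hb]; positivity
    intro k
    induction k with
    | zero => exact ⟨hB0.ge, aux 0 hB0.ge⟩
    | succ k ih =>
      have : 0 ≤ B (k + 1) := by rw [hBrec]; linarith [ih.1, ih.2]
      exact ⟨this, aux _ this⟩
  have hBn := fun k => (hpos k).1
  have hbp := fun k => (hpos k).2
  have htp : ∀ k, 0 < tau k := by
    intro k; rw [htau]; have := hBn k; positivity
  have hBp : ∀ k, 0 < B (k + 1) := by
    intro k; rw [hBrec]; linarith [hBn k, hbp k]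
  have hbb : ∀ k, b k ^ 2 = lam * tau k * B (k + 1) := by
    intro k
    have h1 := htp k
    have h2 := hBn k
    have hq := Real.sq_sqrt (show 0 ≤ lam ^ 2 * tau k ^ 2 + 4 * lam * tau k * B k by positivity)
    rw [hBrec]
    have h3 := hb k
    set s := √(lam ^ 2 * tau k ^ 2 + 4 * lam * tau k * B k)
    rw [h3]
    linarith
  have hydom : ∀ k, y k ∈ domPhi := by
    intro k
    cases k with
    | zero => rw [hy0]; exact hx0
    | succ k => exact hymem k
  have hlow : ∀ k, ∀ w ∈ domPhi, Gam k (z (k + 1)) - ‖z (k + 1) - xt k‖ ^ 2 / (2 * lam)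
      + (⟪u (k + 1), w - z (k + 1)⟫ + mu / 2 * ‖w - z (k + 1)‖ ^ 2) ≤ Phi w := by
    intro k w hw
    have h1 : Gam k (z (k + 1)) + ⟪uhat (k + 1), w - z (k + 1)⟫
        + (mu + 1 / lam) / 2 * ‖w - z (k + 1)‖ ^ 2 ≤ Gam k w := by
      rcases hz k with ⟨A, hA, hmin, hue⟩ | ⟨hmin, hue⟩
      · rw [hue, real_inner_smul_left]
        apply aux_subgrad domPhi hPhiconv.1 _ _ _ (hGamsc k) _ _ (hzmem k) _ w hw
        intro v hv
        convert hmin v hv using 2 <;> field_simp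
      · have := aux_subgrad domPhi hPhiconv.1 _ 0 _ (hGamsc k) _ (xt k) (hzmem k)
          (by intro v hv; simpa using hmin v hv) w hw
        rw [hue, inner_zero_left]; linarith
    have h2 := hGamle k w hw
    have e : w - xt k = (w - z (k + 1)) - (xt k - z (k + 1)) := by abel
    have e2 : ‖w - xt k‖ ^ 2 / (2 * lam) = ‖w - z (k + 1)‖ ^ 2 / (2 * lam)
        - lam⁻¹ * ⟪xt k - z (k + 1), w - z (k + 1)⟫ + ‖z (k + 1) - xt k‖ ^ 2 / (2 * lam) := by
      rw [e, norm_sub_sq_real, real_inner_comm, norm_sub_rev (z (k + 1)) (xt k)]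
      field_simp
    rw [e2] at h2
    rw [hu, inner_add_left, real_inner_smul_left]
    have e3 : (mu + 1 / lam) / 2 * ‖w - z (k + 1)‖ ^ 2
      = mu / 2 * ‖w - z (k + 1)‖ ^ 2 + ‖w - z (k + 1)‖ ^ 2 / (2 * lam) := by field_simp
    linarith
  have hstep : ∀ k, B (k + 1) * (Phi (y (k + 1)) - Phi xstar)
        + tau (k + 1) / 2 * ‖xstar - x (k + 1)‖ ^ 2
        + B (k + 1) * ((1 - sigma) / (2 * lam) * ‖yt (k + 1) - xt k‖ ^ 2)
      ≤ B k * (Phi (y k) - Phi xstar) + tau k / 2 * ‖xstar - x k‖ ^ 2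
        + delta0 * (B (k + 1) * alpha ^ k) := by
    intro k
    have hA := aux_A xstar (x (k + 1)) (z (k + 1)) (x k) (u (k + 1)) (b k) mu (tau k) (tau (k + 1))
      (htaurec k) (by rw [hxrec k, smul_smul, mul_inv_cancel₀ (htp (k + 1)).ne', one_smul])
    have hB' := aux_B (y k) (x (k + 1)) (z (k + 1)) (x k) (xt k) (u (k + 1)) (uhat (k + 1)) (b k)
      (B k) (B (k + 1)) mu (tau k) lam (htp k) hlam hmu (hbp k).le (hBn k) (hBrec k) (hbb k)
      (by rw [hxt k, smul_add, smul_smul, smul_smul, mul_div_cancel₀ _ (hBp k).ne',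
            mul_div_cancel₀ _ (hBp k).ne']) (hu k)
    have l1 := mul_le_mul_of_nonneg_left (hlow k _ (hydom k)) (hBn k)
    have l2 := mul_le_mul_of_nonneg_left (hlow k _ hxstar) (hbp k).le
    have hi : Phi (y (k + 1)) + (1 - sigma) / (2 * lam) * ‖yt (k + 1) - xt k‖ ^ 2
        - delta0 * alpha ^ k ≤ Gam k (z (k + 1)) - lam / 2 * ‖uhat (k + 1)‖ ^ 2 := by
      have h1 := hineq k
      have h2 := hyle k
      rw [norm_smul, mul_pow, Real.norm_eq_abs, sq_abs] at h1
      have h3 : Phi (yt (k + 1)) + (1 - sigma) / (2 * lam) * ‖yt (k + 1) - xt k‖ ^ 2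
        - delta0 * alpha ^ k ≤ Gam k (z (k + 1)) - lam / 2 * ‖uhat (k + 1)‖ ^ 2 := by
        rw [← sub_nonneg] at h1 ⊢
        have : 0 ≤ (1 / (2 * lam)) * (sigma * ‖yt (k + 1) - xt k‖ ^ 2
          + 2 * lam * (delta0 * alpha ^ k) -
          (lam ^ 2 * ‖uhat (k + 1)‖ ^ 2 +
          2 * lam * (Phi (yt (k + 1)) + ‖yt (k + 1) - xt k‖ ^ 2 / (2 * lam) -
            Gam k (z (k + 1))))) := mul_nonneg (by positivity) h1
        convert this using 1
        field_simp
        ring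
      linarith
    have l3 := mul_le_mul_of_nonneg_left hi (hBp k).le
    have hr := hBrec k
    have hbk : b k = B (k + 1) - B k := by linarith
    rw [hbk] at hA hB' l2
    linarith
  have hnorm : ∀ k, 0 ≤ B (k + 1) * alpha ^ k := fun k => mul_nonneg (hBp k).le (pow_nonneg halpha0 k)
  have hsum : Summable (fun i : ℕ => B (i + 1) * alpha ^ i) := by
    set r := 1 + √(lam * mu) with hr
    have hr1 : 1 ≤ r := by have := Real.sqrt_nonneg (lam * mu); linarith
    have hq : r ^ 2 * alpha < 1 := by
      have : 0 < r ^ 2 := by positivity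
      calc r ^ 2 * alpha < r ^ 2 * (r ^ 2)⁻¹ := by gcongr
        _ = 1 := mul_inv_cancel₀ this.ne'
    have hq0 : 0 ≤ r ^ 2 * alpha := by positivity
    have hs := summable_pow_mul_geometric_of_norm_lt_one 2 (r := r ^ 2 * alpha)
      (by rw [Real.norm_eq_abs, abs_of_nonneg hq0]; exact hq)
    have hs' := (hs.mul_left (4 * lam * r ^ 2)).add
      ((summable_geometric_of_lt_one hq0 hq).mul_left (4 * lam * r ^ 2))
    refine Summable.of_nonneg_of_le hnorm ?_ hs'
    intro k
    have h1 := aux_bound b B tau lam mu hlam hmu hB0 hBn hbp hBrec htau hbb (k + 1)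
    have h2 : B (k + 1) ≤ lam * ((k : ℝ) + 1) ^ 2 * (r ^ 2) ^ (k + 1) := by
      have h3 := pow_le_pow_left₀ (Real.sqrt_nonneg _) h1 2
      rw [Real.sq_sqrt (hBn _), mul_pow, mul_pow, Real.sq_sqrt hlam.le, ← hr] at h3
      push_cast at h3
      rw [← pow_mul, mul_comm 2, pow_mul]; exact h3
    calc B (k + 1) * alpha ^ k ≤ lam * ((k : ℝ) + 1) ^ 2 * (r ^ 2) ^ (k + 1) * alpha ^ k := by gcongr
      _ = lam * r ^ 2 * (r ^ 2 * alpha) ^ k * ((k : ℝ) + 1) ^ 2 := by rw [mul_pow]; ring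
      _ ≤ lam * r ^ 2 * (r ^ 2 * alpha) ^ k * (4 * (k : ℝ) ^ 2 + 4) := by
          gcongr
          nlinarith [sq_nonneg ((k : ℝ) - 1), sq_nonneg (k : ℝ)]
      _ = _ := by ring
  refine ⟨hsum, ?_⟩
  set C := ∑' i : ℕ, B (i + 1) * alpha ^ i with hC
  have hC0 : 0 ≤ C := tsum_nonneg hnorm
  have htel : ∀ k, B k * (Phi (y k) - Phi xstar) + tau k / 2 * ‖xstar - x k‖ ^ 2
      + ∑ i ∈ Finset.range k, B (i + 1) * ((1 - sigma) / (2 * lam) * ‖yt (i + 1) - xt i‖ ^ 2)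
      ≤ R0 ^ 2 / 2 + delta0 * ∑ i ∈ Finset.range k, B (i + 1) * alpha ^ i := by
    intro k
    induction k with
    | zero => simp only [hB0, htau0, hR0, norm_sub_rev xstar, Finset.range_zero, Finset.sum_empty]; linarith
    | succ k ih =>
      rw [Finset.sum_range_succ, Finset.sum_range_succ]
      have := hstep k
      linarith
  have hR : 0 ≤ R0 := by rw [hR0]; positivity
  have hterm : ∀ i, 0 ≤ B (i + 1) * ((1 - sigma) / (2 * lam) * ‖yt (i + 1) - xt i‖ ^ 2) := by
    intro i
    have := (hBp i).le
    have : 0 ≤ 1 - sigma := by linarith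
    positivity
  intro k
  have hmain := htel (k + 1)
  have hpart : delta0 * ∑ i ∈ Finset.range (k + 1), B (i + 1) * alpha ^ i ≤ delta0 * C :=
    mul_le_mul_of_nonneg_left (hsum.sum_le_tsum _ (fun i _ => hnorm i)) hdelta0
  have ht0 : 0 ≤ tau (k + 1) / 2 * ‖xstar - x (k + 1)‖ ^ 2 := by
    have := (htp (k + 1)).le
    positivity
  have hP0 : 0 ≤ B (k + 1) * (Phi (y (k + 1)) - Phi xstar) :=
    mul_nonneg (hBp k).le (sub_nonneg.2 (hxstarmin _ (hymem k)))
  have hg : 0 ≤ 2 * lam * delta0 * C := by positivity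
  refine ⟨?_, ?_⟩
  · have h1 := Finset.sum_nonneg (s := Finset.range (k + 1)) (fun i _ => hterm i)
    have h2 : B (k + 1) * (Phi (y (k + 1)) - Phi xstar) ≤ R0 ^ 2 / 2 + delta0 * C := by linarith
    have : R0 ^ 2 / (2 * B (k + 1)) + delta0 * C / B (k + 1)
        = (R0 ^ 2 / 2 + delta0 * C) / B (k + 1) := by
      have := (hBp k).ne'
      field_simp
    rw [this, le_div_iff₀ (hBp k)]
    linarith
  · intro hs1
    have hs0 : 0 < 1 - sigma := by linarith
    have hS : ∑ i ∈ Finset.range (k + 1), B (i + 1) * ((1 - sigma) / (2 * lam) * ‖yt (i + 1) - xt i‖ ^ 2)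
        ≤ R0 ^ 2 / 2 + delta0 * C := by linarith
    refine ⟨?_, ?_⟩
    · apply aux_root _ _ _ _ _ hlam.le (mul_pos hs0 (hBp k)) (norm_nonneg _) hR hg
      have h1 := Finset.single_le_sum (fun i _ => hterm i) (Finset.self_mem_range_succ k)
      have h2 := mul_le_mul_of_nonneg_left (h1.trans hS) (show 0 ≤ 2 * lam by positivity)
      have h3 : 2 * lam * (B (k + 1) * ((1 - sigma) / (2 * lam) * ‖yt (k + 1) - xt k‖ ^ 2))
        = (1 - sigma) * B (k + 1) * ‖yt (k + 1) - xt k‖ ^ 2 := by field_simp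
      linarith
    · obtain ⟨i, hi, hmin⟩ := Finset.exists_min_image (Finset.range (k + 1))
        (fun i => ‖yt (i + 1) - xt i‖) ⟨0, by simp⟩
      refine ⟨i, Nat.lt_succ_iff.1 (Finset.mem_range.1 hi), ?_⟩
      have hSB : 0 < ∑ j ∈ Finset.range (k + 1), B (j + 1) :=
        Finset.sum_pos (fun j _ => hBp j) ⟨0, by simp⟩
      apply aux_root _ _ _ _ _ hlam.le (mul_pos hs0 hSB) (norm_nonneg _) hR hg
      have h1 : ∑ j ∈ Finset.range (k + 1), B (j + 1) * ((1 - sigma) / (2 * lam) * ‖yt (i + 1) - xt i‖ ^ 2)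
          ≤ R0 ^ 2 / 2 + delta0 * C := by
        refine le_trans (Finset.sum_le_sum fun j hj => ?_) hS
        have := (hBp j).le
        have := hmin j hj
        gcongr
      rw [← Finset.sum_mul] at h1
      have h2 := mul_le_mul_of_nonneg_left h1 (show 0 ≤ 2 * lam by positivity)
      set Q := ∑ j ∈ Finset.range (k + 1), B (j + 1)
      have h3 : 2 * lam * (Q * ((1 - sigma) / (2 * lam) * ‖yt (i + 1) - xt i‖ ^ 2))
        = (1 - sigma) * Q * ‖yt (i + 1) - xt i‖ ^ 2 := by field_simp
      linarith
end
end

section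
/- Assume that at every outer iteration the inner ACG call of Restarted ACG terminates (i.e., the restart condition ‖λ s_j‖² + 2λ[ψ(y_j) − Θ_j(x_j)] ≤ σ‖y_j − x_0‖² is eventually satisfied). Then for every outer iteration k ≥ 1, the function value gap satisfies φ(w_k) − φ_* ≤ min{ 2R_0²/(λk²), (R_0²/(2λ))·(1 + √(λμ_f)/2)^{−2(k−1)} }, where R_0 = min{‖w_0 − x‖ : x ∈ X_*}. -/
noncomputable section

open Set
open scoped RealInnerProductSpace BigOperators

variable {n m : ℕ}

/-- One full run of the ACG method (Algorithm 1) on `ψ = g + h` with parameters `L`, `μ`,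
started at `x0 ∈ dom h`.  The minimizations defining `ỹ_{j+1}` are taken over `dom h`
(`h` is interpreted as `+∞` outside of `dom h`). -/
def ACGSpec (domh : Set (Euc n)) (g h : Euc n → ℝ) (g' : Euc n → Euc n) (L mu : ℝ)
    (x0 : Euc n) (x y xt yt : ℕ → Euc n) (a A tau : ℕ → ℝ) : Prop :=
  A 0 = 0 ∧ tau 0 = 1 ∧ x 0 = x0 ∧ y 0 = x0 ∧ x0 ∈ domh ∧
  (∀ j, a j = (tau j + Real.sqrt (tau j ^ 2 + 8 * tau j * A j * L)) / (4 * L)) ∧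
  (∀ j, A (j + 1) = A j + a j) ∧
  (∀ j, tau (j + 1) = tau j + mu * a j) ∧
  (∀ j, xt j = (A j / A (j + 1)) • y j + (a j / A (j + 1)) • x j) ∧
  (∀ j, yt (j + 1) ∈ domh) ∧
  (∀ j, ∀ u ∈ domh,
      g (xt j) + ⟪g' (xt j), yt (j + 1) - xt j⟫ + h (yt (j + 1)) +
          (2 * L + mu) / 2 * ‖yt (j + 1) - xt j‖ ^ 2 ≤
        g (xt j) + ⟪g' (xt j), u - xt j⟫ + h u +
          (2 * L + mu) / 2 * ‖u - xt j‖ ^ 2) ∧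
  (∀ j, (y (j + 1) = y j ∨ y (j + 1) = yt (j + 1)) ∧
      g (y (j + 1)) + h (y (j + 1)) ≤ g (y j) + h (y j) ∧
      g (y (j + 1)) + h (y (j + 1)) ≤ g (yt (j + 1)) + h (yt (j + 1))) ∧
  (∀ j, x (j + 1) = (A (j + 1) * mu + 1)⁻¹ •
      (((2 * L + mu) * a j) • yt (j + 1) -
        (2 * A j * a j * L / A (j + 1)) • y j))

/-- The aggregate lower model `Θ_j` of the ACG run: `Θ_0 ≡ 0` and
`Θ_{j+1} = (A_j Θ_j + a_j θ_{j+1})/A_{j+1}`, where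
`θ_{j+1}(w) = Γ_j(ỹ_{j+1}) - L‖ỹ_{j+1} - x̃_j‖² + ⟪2L(x̃_j - ỹ_{j+1}), w - ỹ_{j+1}⟫ + (μ/2)‖w - ỹ_{j+1}‖²`
and `Γ_j(u) = g(x̃_j) + ⟪∇g(x̃_j), u - x̃_j⟫ + h(u) + ((2L+μ)/2)‖u - x̃_j‖²`. -/
def ThetaSpec (g h : Euc n → ℝ) (g' : Euc n → Euc n) (L mu : ℝ)
    (xt yt : ℕ → Euc n) (a A : ℕ → ℝ) (Th : ℕ → Euc n → ℝ) : Prop :=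
  (∀ w, Th 0 w = 0) ∧
  ∀ j w, Th (j + 1) w =
    (A j * Th j w + a j *
      (g (xt j) + ⟪g' (xt j), yt (j + 1) - xt j⟫ + h (yt (j + 1)) +
          (2 * L + mu) / 2 * ‖yt (j + 1) - xt j‖ ^ 2 -
        L * ‖yt (j + 1) - xt j‖ ^ 2 +
        ⟪(2 * L) • (xt j - yt (j + 1)), w - yt (j + 1)⟫ +
        mu / 2 * ‖w - yt (j + 1)‖ ^ 2)) / A (j + 1)
/-- A full run of the Restarted ACG method (Algorithm 2) on `φ = f + h`, with inner ACG
runs `(xin k, yin k, xtin k, ytin k, ain k, Ain k, tauin k)` on the proximal subproblem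
`ψ_k(·) = f(·) + h(·) + ‖· - ṽ_k‖²/(2λ)`, aggregate lower models `Thin k`, and inner
termination indices `J k` at which the restart condition is satisfied. -/
def RestartSpec (domh : Set (Euc n)) (f h : Euc n → ℝ) (f' : Euc n → Euc n)
    (muf Lf lam sigma : ℝ)
    (w v vt : ℕ → Euc n) (bo Bo tauo : ℕ → ℝ)
    (xin yin xtin ytin : ℕ → ℕ → Euc n) (ain Ain tauin : ℕ → ℕ → ℝ)
    (Thin : ℕ → ℕ → Euc n → ℝ) (J : ℕ → ℕ) : Prop :=
  Bo 0 = 0 ∧ tauo 0 = 1 ∧ v 0 = w 0 ∧ w 0 ∈ domh ∧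
  (∀ k, bo k = (tauo k * lam +
      Real.sqrt (tauo k ^ 2 * lam ^ 2 + 4 * tauo k * lam * Bo k)) / 2) ∧
  (∀ k, Bo (k + 1) = Bo k + bo k) ∧
  (∀ k, tauo (k + 1) = tauo k + bo k * muf) ∧
  (∀ k, vt k = (Bo k / Bo (k + 1)) • w k + (bo k / Bo (k + 1)) • v k) ∧
  -- inner ACG runs on `ψ_k` from `x_0 = ṽ_k` with `L = L_f - μ_f`, `μ = μ_f + 1/λ`
  (∀ k, ACGSpec domh (fun u => f u + ‖u - vt k‖ ^ 2 / (2 * lam)) h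
      (fun u => f' u + lam⁻¹ • (u - vt k)) (Lf - muf) (muf + 1 / lam)
      (vt k) (xin k) (yin k) (xtin k) (ytin k) (ain k) (Ain k) (tauin k)) ∧
  (∀ k, ThetaSpec (fun u => f u + ‖u - vt k‖ ^ 2 / (2 * lam)) h
      (fun u => f' u + lam⁻¹ • (u - vt k)) (Lf - muf) (muf + 1 / lam)
      (xtin k) (ytin k) (ain k) (Ain k) (Thin k)) ∧
  (∀ k, 1 ≤ J k) ∧
  -- the restart condition holds at inner iteration `J k`
  (∀ k,
      ‖lam • ((Ain k (J k))⁻¹ • (vt k - xin k (J k)))‖ ^ 2 +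
        2 * lam * ((f (yin k (J k)) + ‖yin k (J k) - vt k‖ ^ 2 / (2 * lam) +
            h (yin k (J k))) - Thin k (J k) (xin k (J k))) ≤
      sigma * ‖yin k (J k) - vt k‖ ^ 2) ∧
  -- `w_{k+1}` is the better of `w_k` and the output `y_{J k}` of the inner call
  (∀ k, (w (k + 1) = w k ∨ w (k + 1) = yin k (J k)) ∧
      f (w (k + 1)) + h (w (k + 1)) ≤ f (w k) + h (w k) ∧
      f (w (k + 1)) + h (w (k + 1)) ≤ f (yin k (J k)) + h (yin k (J k))) ∧
  -- the `v`-update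
  (∀ k, v (k + 1) = (tauo (k + 1))⁻¹ •
      (tauo k • v k + (bo k * muf) • xin k (J k) -
        (bo k * (Ain k (J k) + lam) / lam) •
          ((Ain k (J k))⁻¹ • (vt k - xin k (J k)))))
/-!
STATEMENT 11 (Proposition: outer sub-optimality guarantee of Restarted ACG).
-/

section helpers
variable {E : Type*} [NormedAddCommGroup E] [InnerProductSpace ℝ E]

lemma aux_three (g x v vk u : E) (b m t c : ℝ)
    (hs : b • g + (b * m) • (v - x) + t • (v - vk) = 0) :
    b * (c + ⟪g, u - x⟫ + m / 2 * ‖u - x‖ ^ 2) + t / 2 * ‖u - vk‖ ^ 2 =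
      b * (c + ⟪g, v - x⟫ + m / 2 * ‖v - x‖ ^ 2) + t / 2 * ‖v - vk‖ ^ 2
        + (t + b * m) / 2 * ‖u - v‖ ^ 2 := by
  have h1 : ⟪b • g + (b * m) • (v - x) + t • (v - vk), u - v⟫ = 0 := by
    rw [hs, inner_zero_left]
  have e1 : u - x = (u - v) + (v - x) := by abel
  have e2 : u - vk = (u - v) + (v - vk) := by abel
  rw [e1, e2, norm_add_sq_real, norm_add_sq_real, inner_add_right]
  simp only [inner_add_left, inner_smul_left, RCLike.conj_to_real] at h1
  rw [real_inner_comm (v - x) (u - v), real_inner_comm (v - vk) (u - v)] at *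
  linear_combination h1

lemma aux_conv (g x w v z : E) (B b m c : ℝ) (hB : 0 ≤ B) (hb : 0 ≤ b) (hm : 0 ≤ m)
    (hz : (B + b) • z = B • w + b • v) :
    (B + b) * (c + ⟪g, z - x⟫ + m / 2 * ‖z - x‖ ^ 2) ≤
      B * (c + ⟪g, w - x⟫ + m / 2 * ‖w - x‖ ^ 2) +
        b * (c + ⟪g, v - x⟫ + m / 2 * ‖v - x‖ ^ 2) := by
  have hz' : B • (w - z) + b • (v - z) = 0 := by
    have : B • (w - z) + b • (v - z) = (B • w + b • v) - (B + b) • z := by module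
    rw [this, hz, sub_self]
  have h1 : ∀ p : E, B * ⟪p, w - z⟫ + b * ⟪p, v - z⟫ = 0 := by
    intro p
    have : ⟪p, B • (w - z) + b • (v - z)⟫ = 0 := by rw [hz', inner_zero_right]
    simpa only [inner_add_right, inner_smul_right] using this
  have e1 : w - x = (z - x) + (w - z) := by abel
  have e2 : v - x = (z - x) + (v - z) := by abel
  have h2 := h1 g
  have h3 := h1 (z - x)
  rw [e1, e2, norm_add_sq_real, norm_add_sq_real, inner_add_right, inner_add_right]
  have h4 : 0 ≤ m / 2 * (B * ‖w - z‖ ^ 2 + b * ‖v - z‖ ^ 2) := by positivity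
  linear_combination h4 - h2 - m * h3

lemma aux_step (x s w v vk vt z u y : E) (B b m t lam A th : ℝ)
    (pw pu py pw' sigma : ℝ)
    (hlam : 0 < lam) (hB : 0 ≤ B) (hb : 0 < b) (hm : 0 ≤ m) (ht : 0 ≤ t)
    (hsig : sigma < 1)
    (hs : vt - x = A • s)
    (hb2 : b ^ 2 = t * lam * (B + b))
    (hvt : (B + b) • vt = B • w + b • vk)
    (hv : (t + b * m) • v = t • vk + (b * m) • x - (b * (A + lam) / lam) • s)
    (hpw : th + ⟪s, w - x⟫ + (m + 1 / lam) / 2 * ‖w - x‖ ^ 2 ≤ pw + ‖w - vt‖ ^ 2 / (2 * lam))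
    (hpu : th + ⟪s, u - x⟫ + (m + 1 / lam) / 2 * ‖u - x‖ ^ 2 ≤ pu + ‖u - vt‖ ^ 2 / (2 * lam))
    (hr : ‖lam • s‖ ^ 2 + 2 * lam * ((py + ‖y - vt‖ ^ 2 / (2 * lam)) - th)
       ≤ sigma * ‖y - vt‖ ^ 2)
    (hw' : pw' ≤ py) :
    (B + b) * (pw' - pu) + (t + b * m) / 2 * ‖u - v‖ ^ 2 ≤
      B * (pw - pu) + t / 2 * ‖u - vk‖ ^ 2 := by
  have hBb : 0 < B + b := by linarith
  set g : E := ((A + lam) / lam) • s with hg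
  set c : ℝ := th - ‖x - vt‖ ^ 2 / (2 * lam) with hc
  -- q rewrite
  have hq : ∀ p : E, th + ⟪s, p - x⟫ + (m + 1 / lam) / 2 * ‖p - x‖ ^ 2
      = (c + ⟪g, p - x⟫ + m / 2 * ‖p - x‖ ^ 2) + ‖p - vt‖ ^ 2 / (2 * lam) := by
    intro p
    have e : p - vt = (p - x) - A • s := by rw [← hs]; abel
    have e' : x - vt = - (A • s) := by rw [← hs]; abel
    rw [hc, hg, e, e', norm_neg, norm_sub_sq_real (p - x), inner_smul_left, inner_smul_right,
      real_inner_comm s (p - x), RCLike.conj_to_real]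
    field_simp
    ring
  have hstat : b • g + (b * m) • (v - x) + t • (v - vk) = 0 := by
    have : b • g + (b * m) • (v - x) + t • (v - vk) =
      (t + b * m) • v - (t • vk + (b * m) • x - (b * (A + lam) / lam) • s) := by
      rw [hg, mul_div_assoc]; module
    rw [this, hv, sub_self]
  have h3 := aux_three g x v vk u b m t c hstat
  set z : E := (B + b)⁻¹ • (B • w + b • v) with hzdef
  have hz : (B + b) • z = B • w + b • v := by
    rw [hzdef, smul_inv_smul₀ hBb.ne']
  have h4 := aux_conv g x w v z B b m c hB hb.le hm hz
  have h5 : (B + b) ^ 2 * ‖z - vt‖ ^ 2 = b ^ 2 * ‖v - vk‖ ^ 2 := by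
    have : (B + b) • (z - vt) = b • (v - vk) := by
      rw [smul_sub, hz, hvt]; module
    have h6 := congrArg (fun p => ‖p‖ ^ 2) this
    simpa [norm_smul, mul_pow, sq_abs] using h6
  have h6 : t / 2 * ‖v - vk‖ ^ 2 = (B + b) * (‖z - vt‖ ^ 2 / (2 * lam)) := by
    rw [hb2] at h5
    have : (B + b) * ‖z - vt‖ ^ 2 = t * lam * ‖v - vk‖ ^ 2 := by
      apply mul_left_cancel₀ hBb.ne'
      linear_combination h5
    field_simp
    linear_combination -this
  have h7 : th - lam / 2 * ‖s‖ ^ 2 ≤ th + ⟪s, z - x⟫ + (m + 1 / lam) / 2 * ‖z - x‖ ^ 2 := by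
    have h8 : 0 ≤ ‖lam • s + (z - x)‖ ^ 2 / (2 * lam) := by positivity
    rw [norm_add_sq_real, norm_smul, inner_smul_left, RCLike.conj_to_real, mul_pow,
      Real.norm_eq_abs, sq_abs] at h8
    have h9 : 0 ≤ m / 2 * ‖z - x‖ ^ 2 := by positivity
    have h10 : (lam ^ 2 * ‖s‖ ^ 2 + 2 * (lam * ⟪s, z - x⟫) + ‖z - x‖ ^ 2) / (2 * lam)
      = lam / 2 * ‖s‖ ^ 2 + ⟪s, z - x⟫ + 1 / lam / 2 * ‖z - x‖ ^ 2 := by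
      field_simp
    rw [h10] at h8
    linarith
  have h8 : py ≤ th - lam / 2 * ‖s‖ ^ 2 := by
    rw [norm_smul, mul_pow, Real.norm_eq_abs, sq_abs] at hr
    have h9 : 2 * lam * ((py + ‖y - vt‖ ^ 2 / (2 * lam)) - th)
      = 2 * lam * (py - th) + ‖y - vt‖ ^ 2 := by field_simp; ring
    rw [h9] at hr
    have h10 : 0 ≤ (1 - sigma) * ‖y - vt‖ ^ 2 := by
      have : 0 ≤ 1 - sigma := by linarith
      positivity
    have h11 : (2 * lam) * (py - (th - lam / 2 * ‖s‖ ^ 2)) ≤ 0 := by linarith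
    have h12 : 0 < 2 * lam := by linarith
    by_contra hcon
    push Not at hcon
    have := mul_pos h12 (sub_pos.2 hcon)
    linarith
  rw [hq] at hpw hpu h7
  have k1 : B * (c + ⟪g, w - x⟫ + m / 2 * ‖w - x‖ ^ 2) ≤ B * pw :=
    mul_le_mul_of_nonneg_left (by linarith) hB
  have k2 : b * (c + ⟪g, u - x⟫ + m / 2 * ‖u - x‖ ^ 2) ≤ b * pu :=
    mul_le_mul_of_nonneg_left (by linarith) hb.le
  have k3 : (B + b) * pw' ≤ (B + b) * ((c + ⟪g, z - x⟫ + m / 2 * ‖z - x‖ ^ 2) + ‖z - vt‖ ^ 2 / (2 * lam)) :=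
    mul_le_mul_of_nonneg_left (by linarith) hBb.le
  linarith

lemma aux_theta (x0 x x' xt yt u : E) (P Px Px' A a L mu : ℝ) 
    (hu : P = Px + ⟪x0 - x, u - x⟫ + A * mu / 2 * ‖u - x‖ ^ 2)
    (hx' : Px' = Px + ⟪x0 - x, x' - x⟫ + A * mu / 2 * ‖x' - x‖ ^ 2)
    (hs : (1 + mu * A) • (x' - x) + a • ((2 * L) • (xt - yt) + mu • (x' - yt)) = 0) :
    P + a * (⟪(2 * L) • (xt - yt), u - yt⟫ + mu / 2 * ‖u - yt‖ ^ 2) =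
    Px' + a * (⟪(2 * L) • (xt - yt), x' - yt⟫ + mu / 2 * ‖x' - yt‖ ^ 2)
     + ⟪x0 - x', u - x'⟫ + (A + a) * mu / 2 * ‖u - x'‖ ^ 2 := by
  have h1 : ⟪(1 + mu * A) • (x' - x) + a • ((2 * L) • (xt - yt) + mu • (x' - yt)), u - x'⟫ = 0 := by
    rw [hs, inner_zero_left]
  have e1 : u - x = (u - x') + (x' - x) := by abel
  have e2 : u - yt = (u - x') + (x' - yt) := by abel
  have e3 : x0 - x' = (x0 - x) - (x' - x) := by abel
  rw [hu, hx', e1, e2, e3, norm_add_sq_real, norm_add_sq_real, inner_add_right, inner_add_right,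
    inner_sub_left (x0 - x) (x' - x)]
  simp only [inner_add_left, inner_smul_left, RCLike.conj_to_real] at h1 ⊢
  rw [real_inner_comm (x' - x) (u - x'), real_inner_comm (x' - yt) (u - x')] at *
  linear_combination h1

end helpers

lemma sc_grad (f : Euc n → ℝ) (f' : Euc n → Euc n) (mu : ℝ) (hf : SCOn Set.univ mu f)
    (hg : ∀ x, HasGradientAt f (f' x) x) (x u : Euc n) :
    f x + ⟪f' x, u - x⟫ + mu / 2 * ‖u - x‖ ^ 2 ≤ f u := by
  have hd : HasDerivAt (fun t : ℝ => f (x + t • (u - x))) ⟪f' x, u - x⟫ 0 := by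
    have h1 : HasFDerivAt f (InnerProductSpace.toDual ℝ _ (f' x)) (x + (0:ℝ) • (u - x)) := by
      simpa using (hg x).hasFDerivAt
    have h2 : HasDerivAt (fun t : ℝ => x + t • (u - x)) (u - x) 0 := by
      simpa using ((hasDerivAt_id (0:ℝ)).smul_const (u - x)).const_add x
    have h3 := h1.comp_hasDerivAt (0:ℝ) h2
    rw [InnerProductSpace.toDual_apply_apply] at h3
    exact h3
  have ht := hd.tendsto_slope_zero_right
  have hR : Filter.Tendsto (fun t : ℝ => f u - f x - mu / 2 * (1 - t) * ‖u - x‖ ^ 2)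
      (nhdsWithin 0 (Set.Ioi 0)) (nhds (f u - f x - mu / 2 * (1 - 0) * ‖u - x‖ ^ 2)) := by
    apply Filter.Tendsto.mono_left _ nhdsWithin_le_nhds
    apply Continuous.tendsto (f := fun t : ℝ => f u - f x - mu / 2 * (1 - t) * ‖u - x‖ ^ 2)
    fun_prop
  have hle := le_of_tendsto_of_tendsto ht hR (by
    filter_upwards [Ioo_mem_nhdsGT (zero_lt_one' ℝ)] with t ht
    have h3 := hf (Set.mem_univ u) (Set.mem_univ x) ht.1.le (by linarith [ht.2] : 0 ≤ 1 - t) (by ring)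
    have e : t • u + (1 - t) • x = x + t • (u - x) := by module
    rw [e] at h3
    simp only [zero_add, zero_smul, add_zero, smul_eq_mul]
    rw [inv_mul_le_iff₀ ht.1]
    linarith)
  linarith

/-- strong minimizer growth for convex h plus quadratic -/
lemma prox_growth (domh : Set (Euc n)) (h : Euc n → ℝ) (hh : ConvexOn ℝ domh h)
    (p xt yt u : Euc n) (c M : ℝ) (hyt : yt ∈ domh) (hu : u ∈ domh)
    (hmin : ∀ u ∈ domh, c + ⟪p, yt - xt⟫ + h yt + M / 2 * ‖yt - xt‖ ^ 2 ≤
      c + ⟪p, u - xt⟫ + h u + M / 2 * ‖u - xt‖ ^ 2) :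
    c + ⟪p, yt - xt⟫ + h yt + M / 2 * ‖yt - xt‖ ^ 2 + M / 2 * ‖u - yt‖ ^ 2 ≤
      c + ⟪p, u - xt⟫ + h u + M / 2 * ‖u - xt‖ ^ 2 := by
  have key : ∀ t ∈ Set.Ioo (0:ℝ) 1,
     c + ⟪p, yt - xt⟫ + h yt + M / 2 * ‖yt - xt‖ ^ 2 + M / 2 * (1 - t) * ‖u - yt‖ ^ 2 ≤
      c + ⟪p, u - xt⟫ + h u + M / 2 * ‖u - xt‖ ^ 2 := by
    intro t ht
    have h1 : 0 ≤ 1 - t := by linarith [ht.2]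
    have h2 := hmin _ (hh.1 hu hyt ht.1.le h1 (by ring))
    have h3 := hh.2 hu hyt ht.1.le h1 (by ring)
    simp only [smul_eq_mul] at h3
    have e1 : t • u + (1 - t) • yt - xt = t • (u - yt) + (yt - xt) := by module
    have e2 : u - xt = (u - yt) + (yt - xt) := by abel
    rw [e1, norm_add_sq_real, inner_add_right, inner_smul_left, inner_smul_right, norm_smul,
      mul_pow, Real.norm_eq_abs, sq_abs, RCLike.conj_to_real] at h2
    rw [e2, norm_add_sq_real, inner_add_right]
    have h4 : t * 0 ≤ t * (⟪p, u - yt⟫ + h u - h yt + M * ⟪u - yt, yt - xt⟫ + M / 2 * t * ‖u - yt‖ ^ 2) := by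
      linarith
    have h5 := le_of_mul_le_mul_left h4 ht.1
    linarith
  have hL : Filter.Tendsto (fun t : ℝ => c + ⟪p, yt - xt⟫ + h yt + M / 2 * ‖yt - xt‖ ^ 2 + M / 2 * (1 - t) * ‖u - yt‖ ^ 2)
      (nhdsWithin 0 (Set.Ioi 0)) (nhds (c + ⟪p, yt - xt⟫ + h yt + M / 2 * ‖yt - xt‖ ^ 2 + M / 2 * (1 - 0) * ‖u - yt‖ ^ 2)) := by
    apply Filter.Tendsto.mono_left _ nhdsWithin_le_nhds
    apply Continuous.tendsto (f := fun t : ℝ => c + ⟪p, yt - xt⟫ + h yt + M / 2 * ‖yt - xt‖ ^ 2 + M / 2 * (1 - t) * ‖u - yt‖ ^ 2)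
    fun_prop
  have := le_of_tendsto hL (by
    filter_upwards [Ioo_mem_nhdsGT (zero_lt_one' ℝ)] with t ht using key t ht)
  simpa using this

lemma acg_main (domh : Set (Euc n)) (g h : Euc n → ℝ) (g' : Euc n → Euc n) (L mu : ℝ)
    (x0 : Euc n) (x y xt yt : ℕ → Euc n) (a A tau : ℕ → ℝ) (Th : ℕ → Euc n → ℝ)
    (hL : 0 < L) (hmu : 0 ≤ mu)
    (hg : ∀ x u, g x + ⟪g' x, u - x⟫ + mu / 2 * ‖u - x‖ ^ 2 ≤ g u)
    (hh : ConvexOn ℝ domh h)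
    (hacg : ACGSpec domh g h g' L mu x0 x y xt yt a A tau)
    (hth : ThetaSpec g h g' L mu xt yt a A Th) (j : ℕ) (hj : 1 ≤ j) :
    0 < A j ∧ y j ∈ domh ∧ ∀ u ∈ domh,
      Th j (x j) + ⟪(A j)⁻¹ • (x0 - x j), u - x j⟫ + mu / 2 * ‖u - x j‖ ^ 2 ≤ g u + h u := by
  obtain ⟨hA0, htau0, hx0, hy0, hx0d, ha, hA, htau, hxt, hytd, hmin, hy, hx⟩ := hacg
  obtain ⟨hth0, hths⟩ := hth
  have hbasic : ∀ j, 0 ≤ A j ∧ tau j = 1 + mu * A j := by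
    intro j
    induction j with
    | zero => simp [hA0, htau0]
    | succ j ih =>
      obtain ⟨i1, i2⟩ := ih
      have : 0 ≤ tau j := by rw [i2]; positivity
      have haj : 0 ≤ a j := by rw [ha]; positivity
      refine ⟨by rw [hA]; positivity, ?_⟩
      rw [htau, hA, i2]; ring
  have htau1 : ∀ j, 1 ≤ tau j := by
    intro j; rw [(hbasic j).2]; have := mul_nonneg hmu (hbasic j).1; linarith
  have hapos : ∀ j, 0 < a j := by
    intro j; rw [ha]; have := htau1 j; positivity
  have haq : ∀ j, 2 * L * a j ^ 2 = tau j * A (j + 1) := by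
    intro j
    have h1 := htau1 j
    have h2 := (hbasic j).1
    have hsq := Real.sq_sqrt (show 0 ≤ tau j ^ 2 + 8 * tau j * A j * L by positivity)
    rw [hA]
    have h3 : Real.sqrt (tau j ^ 2 + 8 * tau j * A j * L) = 4 * L * a j - tau j := by
      rw [ha]; field_simp; ring
    rw [h3] at hsq
    have h4 : (8 * L) * (2 * L * a j ^ 2) = (8 * L) * (tau j * (A j + a j)) := by
      linear_combination hsq
    exact mul_left_cancel₀ (by positivity) h4
  have hApos : ∀ j, 0 < A (j + 1) := by
    intro j; rw [hA]; have := hapos j; have := (hbasic j).1; linarith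
  have hyd : ∀ j, y j ∈ domh := by
    intro j
    induction j with
    | zero => rw [hy0]; exact hx0d
    | succ j ih =>
      rcases (hy j).1 with h1 | h1 <;> rw [h1]
      · exact ih
      · exact hytd j
  have hstat : ∀ j, (1 + mu * A j) • (x (j+1) - x j) + a j • ((2 * L) • (xt j - yt (j+1)) + mu • (x (j+1) - yt (j+1))) = 0 := by
    intro j
    have hAp := hApos j
    have h1 : (A (j + 1) * mu + 1) • x (j+1) = ((2 * L + mu) * a j) • yt (j + 1) -
        (2 * A j * a j * L / A (j + 1)) • y j := by
      rw [hx, smul_inv_smul₀]; positivity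
    have h2 : (1 + mu * A j) = 2 * L * a j ^ 2 / A (j+1) := by
      rw [haq, (hbasic j).2]; field_simp
    have h3 : (1 + mu * A j) • (x (j+1) - x j) + a j • ((2 * L) • (xt j - yt (j+1)) + mu • (x (j+1) - yt (j+1)))
      = (A (j + 1) * mu + 1) • x (j+1) - (1 + mu * A j) • x j + (2 * L * a j) • xt j - ((2 * L + mu) * a j) • yt (j + 1) := by
      rw [hA]; module
    rw [h3, h1, h2, hxt]
    module
  have hupd : ∀ j u, A (j+1) * Th (j+1) u = A j * Th j u + a j *
      (g (xt j) + ⟪g' (xt j), yt (j + 1) - xt j⟫ + h (yt (j + 1)) +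
          (2 * L + mu) / 2 * ‖yt (j + 1) - xt j‖ ^ 2 -
        L * ‖yt (j + 1) - xt j‖ ^ 2 +
        ⟪(2 * L) • (xt j - yt (j + 1)), u - yt (j + 1)⟫ +
        mu / 2 * ‖u - yt (j + 1)‖ ^ 2) := by
    intro j u
    rw [hths, mul_div_cancel₀ _ (hApos j).ne']
  have hquad : ∀ j u, A j * Th j u = A j * Th j (x j) + ⟪x0 - x j, u - x j⟫ +
      A j * mu / 2 * ‖u - x j‖ ^ 2 := by
    intro j
    induction j with
    | zero => intro u; simp [hA0, hx0]
    | succ j ih =>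
      intro u
      have := aux_theta x0 (x j) (x (j+1)) (xt j) (yt (j+1)) u _ _ _ (A j) (a j) L mu
        (ih u) (ih (x (j+1))) (hstat j)
      rw [hupd j u, hupd j (x (j+1)), hA]
      linear_combination this
  have hlow : ∀ j, ∀ u ∈ domh, A j * Th j u ≤ A j * (g u + h u) := by
    intro j u hu
    induction j with
    | zero => simp [hA0]
    | succ j ih =>
      rw [hupd, hA, add_mul]
      refine add_le_add ih (mul_le_mul_of_nonneg_left ?_ (hapos j).le)
      have h1 := prox_growth domh h hh (g' (xt j)) (xt j) (yt (j+1)) u (g (xt j)) (2 * L + mu)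
        (hytd j) hu (hmin j)
      have h2 := hg (xt j) u
      have e : u - xt j = (u - yt (j+1)) - (xt j - yt (j+1)) := by abel
      have e3 : ‖u - xt j‖ ^ 2 = ‖u - yt (j+1)‖ ^ 2 - 2 * ⟪xt j - yt (j+1), u - yt (j+1)⟫
          + ‖yt (j+1) - xt j‖ ^ 2 := by
        rw [e, norm_sub_sq_real, real_inner_comm, norm_sub_rev (xt j)]
      rw [inner_smul_left, RCLike.conj_to_real]
      linear_combination h1 + h2 + L * e3
  obtain ⟨i, rfl⟩ : ∃ i, j = i + 1 := ⟨j - 1, by omega⟩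
  have hAp := hApos i
  refine ⟨hAp, hyd _, fun u hu => ?_⟩
  have h1 := hquad (i+1) u
  have h2 := hlow (i+1) u hu
  apply le_of_mul_le_mul_left _ hAp
  refine le_trans (le_of_eq ?_) h2
  rw [h1, inner_smul_left, RCLike.conj_to_real]
  field_simp

lemma B_growth (B b t lam p : ℝ) (hB : 0 ≤ B) (ht : 0 ≤ t) (hlam : 0 ≤ lam) (hp : 0 ≤ p)
    (hpt : p ^ 2 ≤ t * lam)
    (hb : b = (t * lam + Real.sqrt (t ^ 2 * lam ^ 2 + 4 * t * lam * B)) / 2) :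
    Real.sqrt B + p / 2 ≤ Real.sqrt (B + b) := by
  apply Real.le_sqrt_of_sq_le
  have hS := Real.sq_sqrt hB
  have hS0 := Real.sqrt_nonneg B
  have h1 : 2 * p * Real.sqrt B ≤ Real.sqrt (t ^ 2 * lam ^ 2 + 4 * t * lam * B) := by
    apply Real.le_sqrt_of_sq_le
    have : p ^ 2 * B ≤ t * lam * B := mul_le_mul_of_nonneg_right hpt hB
    have h2 : 0 ≤ t ^ 2 * lam ^ 2 := by positivity
    rw [mul_pow, hS]; linarith
  rw [hb]
  nlinarith [sq_nonneg p]

theorem restarted_acg_outer_guarantee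
    (domh : Set (Euc n)) (f h : Euc n → ℝ) (f' : Euc n → Euc n)
    (muf Lf lam sigma : ℝ)
    (hLf : 0 < Lf) (hmuf : 0 ≤ muf) (hLf2 : 2 * muf ≤ Lf)
    (hsigma0 : 0 < sigma) (hsigma1 : sigma < 1) (hlam : 0 < lam)
    (hfconv : SCOn Set.univ muf f) (hfsmooth : HasLipGrad f f' Lf)
    (hflsc : LowerSemicontinuous f)
    (hhconv : ConvexOn ℝ domh h) (hdomclosed : IsClosed domh)
    (hhlsc : LowerSemicontinuousOn h domh) (hdomne : domh.Nonempty)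
    -- a run of Restarted ACG in which every inner ACG call terminates
    (w v vt : ℕ → Euc n) (bo Bo tauo : ℕ → ℝ)
    (xin yin xtin ytin : ℕ → ℕ → Euc n) (ain Ain tauin : ℕ → ℕ → ℝ)
    (Thin : ℕ → ℕ → Euc n → ℝ) (J : ℕ → ℕ)
    (hrun : RestartSpec domh f h f' muf Lf lam sigma w v vt bo Bo tauo
        xin yin xtin ytin ain Ain tauin Thin J)
    -- `xstar ∈ X_*` attains the minimum distance `R0` from `w 0`
    (xstar : Euc n) (R0 : ℝ)
    (hxstar : xstar ∈ domh)
    (hxstarmin : ∀ u ∈ domh, f xstar + h xstar ≤ f u + h u)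
    (hR0 : R0 = ‖w 0 - xstar‖)
    (hR0min : ∀ z ∈ domh, (∀ u ∈ domh, f z + h z ≤ f u + h u) → R0 ≤ ‖w 0 - z‖) :
    ∀ k : ℕ, 1 ≤ k →
      f (w k) + h (w k) - (f xstar + h xstar) ≤
        min (2 * R0 ^ 2 / (lam * (k : ℝ) ^ 2))
          (R0 ^ 2 / (2 * lam) *
            ((1 + Real.sqrt (lam * muf) / 2) ^ (2 * (k - 1)))⁻¹) := by
  obtain ⟨hB0, htau0, hv0, hw0d, hb, hB, htau, hvt, hacg, hth, hJ, hrest, hw, hv⟩ := hrun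
  have hL : 0 < Lf - muf := by linarith
  have hmu : 0 ≤ muf + 1 / lam := by positivity
  have hg : ∀ k x u, (f x + ‖x - vt k‖ ^ 2 / (2 * lam)) + ⟪f' x + lam⁻¹ • (x - vt k), u - x⟫
      + (muf + 1 / lam) / 2 * ‖u - x‖ ^ 2 ≤ f u + ‖u - vt k‖ ^ 2 / (2 * lam) := by
    intro k x u
    have h1 := sc_grad f f' muf hfconv hfsmooth.1 x u
    have e : u - vt k = (u - x) + (x - vt k) := by abel
    rw [e, norm_add_sq_real, inner_add_left, inner_smul_left, RCLike.conj_to_real,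
      real_inner_comm (x - vt k) (u - x)] at *
    have e2 : (‖u - x‖ ^ 2 + 2 * ⟪x - vt k, u - x⟫ + ‖x - vt k‖ ^ 2) / (2 * lam) =
       1 / lam / 2 * ‖u - x‖ ^ 2 + lam⁻¹ * ⟪x - vt k, u - x⟫ + ‖x - vt k‖ ^ 2 / (2 * lam) := by
      field_simp
    rw [e2]
    linarith
  have hin := fun k => acg_main domh _ h _ _ _ _ _ _ _ _ _ _ _ _ hL hmu (hg k) hhconv (hacg k)
    (hth k) (J k) (hJ k)
  have hwd : ∀ k, w k ∈ domh := by
    intro k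
    induction k with
    | zero => exact hw0d
    | succ k ih =>
      rcases (hw k).1 with h1 | h1 <;> rw [h1]
      · exact ih
      · exact (hin k).2.1
  have hbasic : ∀ k, 0 ≤ Bo k ∧ tauo k = 1 + muf * Bo k := by
    intro k
    induction k with
    | zero => simp [hB0, htau0]
    | succ k ih =>
      obtain ⟨i1, i2⟩ := ih
      have : 0 ≤ tauo k := by rw [i2]; positivity
      have haj : 0 ≤ bo k := by rw [hb]; positivity
      refine ⟨by rw [hB]; positivity, ?_⟩
      rw [htau, hB, i2]; ring
  have htau1 : ∀ k, 1 ≤ tauo k := by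
    intro k; rw [(hbasic k).2]; have := mul_nonneg hmuf (hbasic k).1; linarith
  have hbpos : ∀ k, 0 < bo k := by
    intro k; rw [hb]; have := htau1 k; positivity
  have hbq : ∀ k, bo k ^ 2 = tauo k * lam * (Bo k + bo k) := by
    intro k
    have h1 := htau1 k
    have h2 := (hbasic k).1
    have hsq := Real.sq_sqrt (show 0 ≤ tauo k ^ 2 * lam ^ 2 + 4 * tauo k * lam * Bo k by positivity)
    have h3 : Real.sqrt (tauo k ^ 2 * lam ^ 2 + 4 * tauo k * lam * Bo k)
        = 2 * bo k - tauo k * lam := by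
      rw [hb]; ring
    rw [h3] at hsq
    linear_combination hsq / 4
  have hBpos : ∀ k, 0 < Bo (k + 1) := by
    intro k; rw [hB]; have := hbpos k; have := (hbasic k).1; linarith
  have hpot : ∀ k, Bo k * (f (w k) + h (w k) - (f xstar + h xstar)) +
      tauo k / 2 * ‖xstar - v k‖ ^ 2 ≤ R0 ^ 2 / 2 := by
    intro k
    induction k with
    | zero => rw [hB0, htau0, hv0, hR0, norm_sub_rev]; linarith
    | succ k ih =>
      refine le_trans ?_ ih
      obtain ⟨hAp, -, hlow⟩ := hin k
      have hBk := hBpos k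
      have ht1 := htau1 (k + 1)
      rw [htau k, hB k]
      rw [hB k] at hBk
      rw [htau k] at ht1
      have l1 := hlow _ (hwd k)
      have l2 := hlow _ hxstar
      have r := hrest k
      refine aux_step (xin k (J k)) ((Ain k (J k))⁻¹ • (vt k - xin k (J k))) (w k) (v (k+1)) (v k)
        (vt k) 0 xstar (yin k (J k)) (Bo k) (bo k) muf (tauo k) lam (Ain k (J k))
        (Thin k (J k) (xin k (J k))) (f (w k) + h (w k)) (f xstar + h xstar)
        (f (yin k (J k)) + h (yin k (J k))) _ sigma hlam (hbasic k).1 (hbpos k) hmuf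
        (by linarith [htau1 k]) hsigma1 ?_ (hbq k) ?_ ?_ ?_ ?_ ?_ (hw k).2.2
      · rw [smul_inv_smul₀ hAp.ne']
      · rw [hvt k, hB k, smul_add, smul_smul, smul_smul, mul_div_cancel₀ _ hBk.ne',
          mul_div_cancel₀ _ hBk.ne']
      · rw [hv k, htau k, smul_inv_smul₀ (by linarith)]
      · linarith
      · linarith
      · refine le_trans (le_of_eq ?_) r
        ring
  have hgap : ∀ k, 1 ≤ k → ∀ C, 0 < C → C ≤ Bo k →
      f (w k) + h (w k) - (f xstar + h xstar) ≤ R0 ^ 2 / (2 * C) := by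
    intro k hk C hC hCB
    have h1 := hpot k
    have h2 := hxstarmin _ (hwd k)
    have h3 : 0 ≤ tauo k / 2 * ‖xstar - v k‖ ^ 2 := by
      have := htau1 k; positivity
    have h4 := mul_le_mul_of_nonneg_right hCB (sub_nonneg.2 h2)
    rw [le_div_iff₀ (by positivity)]
    linarith
  have hgr1 : ∀ k : ℕ, Real.sqrt lam * k / 2 ≤ Real.sqrt (Bo k) := by
    intro k
    induction k with
    | zero => simp
    | succ k ih =>
      have := B_growth (Bo k) (bo k) (tauo k) lam (Real.sqrt lam) (hbasic k).1
        (by linarith [htau1 k]) hlam.le (Real.sqrt_nonneg _)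
        (by rw [Real.sq_sqrt hlam.le]; nlinarith [htau1 k]) (hb k)
      rw [hB]; push_cast; linarith
  have hgr2 : ∀ k : ℕ, Real.sqrt lam * (1 + Real.sqrt (lam * muf) / 2) ^ k
      ≤ Real.sqrt (Bo (k + 1)) := by
    intro k
    induction k with
    | zero =>
      rw [hB, hb, hB0, htau0]
      simp [Real.sqrt_sq hlam.le]
    | succ k ih =>
      have := B_growth (Bo (k+1)) (bo (k+1)) (tauo (k+1)) lam
        (Real.sqrt (lam * muf) * Real.sqrt (Bo (k+1))) (hbasic _).1
        (by linarith [htau1 (k+1)]) hlam.le (by positivity)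
        (by rw [mul_pow, Real.sq_sqrt (by positivity), Real.sq_sqrt (hbasic _).1, (hbasic _).2]
            linarith) (hb _)
      rw [hB (k+1)]
      refine le_trans ?_ this
      have h0 : 0 ≤ 1 + Real.sqrt (lam * muf) / 2 := by positivity
      have := mul_le_mul_of_nonneg_right ih h0
      rw [pow_succ]
      linarith
  intro k hk
  have hk0 : (0:ℝ) < k := by exact_mod_cast hk
  apply le_min
  · have h1 : lam * (k:ℝ) ^ 2 / 4 ≤ Bo k := by
      have h2 := pow_le_pow_left₀ (by positivity) (hgr1 k) 2
      rw [Real.sq_sqrt (hbasic k).1, div_pow, mul_pow, Real.sq_sqrt hlam.le] at h2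
      linarith
    refine (hgap k hk _ (by positivity) h1).trans (le_of_eq ?_)
    field_simp
    norm_num
  · obtain ⟨i, rfl⟩ : ∃ i, k = i + 1 := ⟨k - 1, by omega⟩
    have hc : 0 < 1 + Real.sqrt (lam * muf) / 2 := by positivity
    have h1 : lam * (1 + Real.sqrt (lam * muf) / 2) ^ (2 * i) ≤ Bo (i + 1) := by
      have h2 := pow_le_pow_left₀ (by positivity) (hgr2 i) 2
      rw [Real.sq_sqrt (hbasic _).1, mul_pow, Real.sq_sqrt hlam.le, ← pow_mul, mul_comm i 2] at h2
      exact h2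
    refine (hgap _ hk _ (by positivity) h1).trans (le_of_eq ?_)
    rw [Nat.add_sub_cancel, ← mul_assoc, div_mul_eq_div_div, div_eq_mul_inv (R0 ^ 2 / (2 * lam))]
end
end

section
/- Let Λ_* = {λ : d(λ) = max_ν d(ν)} be the set of optimal multipliers, R_Λ = min{‖λ_0 − λ‖ : λ ∈ Λ_*}, and R_{Λ̃} = ‖λ̃_* − λ_0‖ where λ̃_* is the unique maximizer of the perturbed dual d̃. If γ_p = ε/(2D) and γ_d = C_0 ε/R_{Λ̃} for some C_0 > 0, then R_{Λ̃} ≤ R_Λ + D/(4C_0). -/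
noncomputable section

open Set
open scoped RealInnerProductSpace BigOperators

variable {n m : ℕ}

/-!
STATEMENT 13 (Lemma: bound on the distance to the maximizer of the doubly perturbed dual).
`d(λ) = min_{x ∈ dom h} L(x,λ)` and
`d̃(λ) = min_{x ∈ dom h} { L(x,λ) + (γ_p/2)‖x - x₀‖² } - (γ_d/2)‖λ - λ₀‖²`,
where `L(x,λ) = f x + h x + ⟪λ, A x - b⟫`.
-/

theorem double_perturbation_distance
    (domh : Set (Euc n)) (f h : Euc n → ℝ) (f' : Euc n → Euc n)
    (A : Euc n →L[ℝ] Euc m) (bvec : Euc m)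
    (Lf D eps gp gd C0 : ℝ)
    (hfconv : ConvexOn ℝ Set.univ f)
    (hfsmooth : HasLipGrad f f' Lf)
    (hhconv : ConvexOn ℝ domh h) (hdomclosed : IsClosed domh)
    (hhlsc : LowerSemicontinuousOn h domh)
    (hslater : ∃ xs ∈ intrinsicInterior ℝ domh, A xs = bvec)
    (hD1 : 1 ≤ D)
    (hdiam : ∀ u ∈ domh, ∀ w ∈ domh, ‖u - w‖ ≤ D)
    (heps : 0 < eps) (hC0 : 0 < C0)
    (x0 : Euc n) (hx0 : x0 ∈ domh) (lam0 : Euc m)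
    (d dt : Euc m → ℝ)
    -- `d` is the Lagrangian dual (with attained inner minimum)
    (hd : ∀ lam : Euc m,
        IsLeast ((fun x => f x + h x + ⟪lam, A x - bvec⟫) '' domh) (d lam))
    -- `d̃` is the doubly perturbed dual (with attained inner minimum)
    (hdt : ∀ lam : Euc m,
        IsLeast
          ((fun x => f x + h x + ⟪lam, A x - bvec⟫ + gp / 2 * ‖x - x0‖ ^ 2) '' domh)
          (dt lam + gd / 2 * ‖lam - lam0‖ ^ 2))
    (lamstar lamt : Euc m) (RLam Rt : ℝ)
    -- `lamstar` is a dual maximizer attaining the minimal distance `RLam` from `lam0`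
    (hlamstar : ∀ nu : Euc m, d nu ≤ d lamstar)
    (hRLam : RLam = ‖lam0 - lamstar‖)
    (hRLammin : ∀ lam' : Euc m, (∀ nu, d nu ≤ d lam') → RLam ≤ ‖lam0 - lam'‖)
    -- `lamt` is the (unique) maximizer of the perturbed dual, at distance `Rt`
    (hlamt : ∀ nu : Euc m, dt nu ≤ dt lamt)
    (hRt : Rt = ‖lamt - lam0‖)
    (hgp : gp = eps / (2 * D)) (hgd : gd = C0 * eps / Rt) :
    Rt ≤ RLam + D / (4 * C0) := by
  have hD0 : 0 < D := by linarith
  rcases (norm_nonneg (lamt - lam0)).eq_or_lt with h0 | hpos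
  · rw [hRt, ← h0, hRLam]; positivity
  rw [← hRt] at hpos
  have hgd0 : 0 < gd := by rw [hgd]; positivity
  have hgp0 : 0 < gp := by rw [hgp]; positivity
  -- bound on the gap
  have hup : dt lamt + gd / 2 * ‖lamt - lam0‖ ^ 2 ≤ d lamt + gp / 2 * D ^ 2 := by
    obtain ⟨x, hx, hxe⟩ := (hd lamt).1
    have h1 := (hdt lamt).2 ⟨x, hx, rfl⟩
    simp only at h1 hxe
    have h2 : ‖x - x0‖ ^ 2 ≤ D ^ 2 := by
      have := hdiam x hx x0 hx0
      gcongr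
    have h3 := mul_le_mul_of_nonneg_left h2 (by positivity : 0 ≤ gp / 2)
    linarith
  have hlow : d lamstar ≤ dt lamstar + gd / 2 * ‖lamstar - lam0‖ ^ 2 := by
    obtain ⟨x, hx, hxe⟩ := (hdt lamstar).1
    have h1 := (hd lamstar).2 ⟨x, hx, rfl⟩
    simp only at h1 hxe
    have h3 : 0 ≤ gp / 2 * ‖x - x0‖ ^ 2 := by positivity
    linarith
  have key : ∀ t : ℝ, 0 < t → t < 1 →
      dt lamstar + (1 - t) * (gd / 2 * ‖lamstar - lamt‖ ^ 2) ≤ dt lamt := by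
    intro t ht ht1
    have hm := hlamt (lamt + t • (lamstar - lamt))
    obtain ⟨x, hx, hxe⟩ := (hdt (lamt + t • (lamstar - lamt))).1
    have h1 := (hdt lamt).2 ⟨x, hx, rfl⟩
    have h2 := (hdt lamstar).2 ⟨x, hx, rfl⟩
    simp only at h1 h2 hxe
    rw [inner_add_left, real_inner_smul_left, inner_sub_left] at hxe
    have e1 : lamt + t • (lamstar - lamt) - lam0
        = (lamt - lam0) + t • (lamstar - lamt) := by abel
    have e2 : lamstar - lam0 = (lamt - lam0) + (lamstar - lamt) := by abel
    rw [e1, norm_add_sq_real, norm_smul, real_inner_smul_right, mul_pow, Real.norm_eq_abs,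
      sq_abs] at hxe
    rw [e2, norm_add_sq_real] at h2
    have h1' := mul_le_mul_of_nonneg_left h1 (by linarith : 0 ≤ 1 - t)
    have h2' := mul_le_mul_of_nonneg_left h2 ht.le
    refine le_of_mul_le_mul_left ?_ ht
    nlinarith
  have hsc : dt lamstar + gd / 2 * ‖lamstar - lamt‖ ^ 2 ≤ dt lamt := by
    by_contra hcon
    push Not at hcon
    have hK0 : 0 ≤ gd / 2 * ‖lamstar - lamt‖ ^ 2 := by positivity
    generalize gd / 2 * ‖lamstar - lamt‖ ^ 2 = K at *
    have hle := hlamt lamstar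
    have hK : 0 < K := by linarith
    have hS : 0 < dt lamstar + K - dt lamt := by linarith
    have := key ((dt lamstar + K - dt lamt) / (2 * K)) (by positivity)
      (by rw [div_lt_one (by positivity)]; linarith)
    have e : (1 - (dt lamstar + K - dt lamt) / (2 * K)) * K
        = K - (dt lamstar + K - dt lamt) / 2 := by field_simp
    linarith
  have hopt := hlamstar lamt
  have hRL : ‖lamstar - lam0‖ = RLam := by rw [hRLam, norm_sub_rev]
  rw [← hRt] at hup
  rw [hRL] at hlow
  have htri : (Rt - RLam) ^ 2 ≤ ‖lamstar - lamt‖ ^ 2 := by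
    have h1 := abs_norm_sub_norm_le (lamt - lam0) (lamstar - lam0)
    rw [← hRt, hRL, sub_sub_sub_cancel_right, norm_sub_rev] at h1
    rw [← sq_abs]
    gcongr
  have htri' := mul_le_mul_of_nonneg_left htri (by positivity : 0 ≤ gd / 2)
  have hfin : gd * Rt * (Rt - RLam) ≤ gp / 2 * D ^ 2 := by nlinarith
  have e1 : gd * Rt = C0 * eps := by rw [hgd]; field_simp
  have e2 : gp / 2 * D ^ 2 = eps * (D / 4) := by rw [hgp]; field_simp; norm_num
  rw [e1, e2] at hfin
  have h5 : C0 * (Rt - RLam) ≤ D / 4 := by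
    refine le_of_mul_le_mul_left ?_ heps
    linarith
  have h6 : Rt - RLam ≤ D / (4 * C0) := by
    rw [le_div_iff₀ (by positivity)]; linarith
  linarith
end
end

section
/- Let φ = f + h where f is convex and L_f-smooth on ℝⁿ and h is proper closed convex with dom h bounded of diameter D. Given 0 < η ≤ 1/L_f and x̃ ∈ dom h, let G = G^η_φ(x̃) be the gradient mapping and x⁺ = x̃ − ηG. Then: (a) φ(x⁺) − φ_* ≤ D‖G‖ − (η/2)‖G‖², where φ_* = min_{x∈dom h} φ(x); (b) if ‖G‖ ≤ ε then there exists v ∈ ∂φ(x⁺) with ‖v‖ ≤ 2ε; (c) if γ > 0, x̄ ∈ dom h, φ_γ(x) = φ(x) + (γ/2)‖x − x̄‖², γ ≤ ε/(2D) and ‖G^η_{φ_γ}(x̃)‖ ≤ ε/2 (the gradient mapping of φ_γ taken with proximal mapping of h), then ‖G^η_φ(x̃)‖ ≤ ε. -/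
noncomputable section

open Set
open scoped RealInnerProductSpace BigOperators

variable {n m : ℕ}

/-!
STATEMENT 14 (Lemma on the composite gradient mapping).
`φ = f + h`, `G = G^η_φ(x̃) = (x̃ - prox_{ηh}(x̃ - η∇f(x̃)))/η`, `x⁺ = x̃ - ηG`.
-/

lemma aux_line (f : Euc n → ℝ) (f' : Euc n → Euc n) (hf : ∀ x, HasGradientAt f (f' x) x)
    (x d : Euc n) (t : ℝ) :
    HasDerivAt (fun s : ℝ => f (x + s • d)) ⟪f' (x + t • d), d⟫ t := by
  have h1 : HasDerivAt (fun s : ℝ => x + s • d) d t := by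
    simpa using ((hasDerivAt_id t).smul_const d).const_add x
  have h2 := (hf (x + t • d)).hasFDerivAt
  have h3 := h2.comp_hasDerivAt t h1
  simpa [Function.comp_def] using h3

lemma aux_descent (f : Euc n → ℝ) (f' : Euc n → Euc n) (L : ℝ) (hf : HasLipGrad f f' L)
    (x y : Euc n) : f y ≤ f x + ⟪f' x, y - x⟫ + L / 2 * ‖y - x‖ ^ 2 := by
  set d := y - x with hd
  have hder : ∀ t : ℝ, HasDerivAt
      (fun s : ℝ => f (x + s • d) - s * ⟪f' x, d⟫ - L / 2 * ‖d‖ ^ 2 * s ^ 2)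
      (⟪f' (x + t • d), d⟫ - ⟪f' x, d⟫ - L / 2 * ‖d‖ ^ 2 * (2 * t)) t := by
    intro t
    have h1 := aux_line f f' hf.1 x d t
    have h2 := (hasDerivAt_id t).mul_const (⟪f' x, d⟫)
    have h3 := (hasDerivAt_pow 2 t).const_mul (L / 2 * ‖d‖ ^ 2)
    have h4 := (h1.sub h2).sub h3
    refine h4.congr_deriv ?_
    norm_num
  have hanti : AntitoneOn
      (fun s : ℝ => f (x + s • d) - s * ⟪f' x, d⟫ - L / 2 * ‖d‖ ^ 2 * s ^ 2) (Set.Ici 0) := by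
    apply antitoneOn_of_deriv_nonpos (convex_Ici 0)
    · exact fun t _ => (hder t).continuousAt.continuousWithinAt
    · exact fun t _ => (hder t).differentiableAt.differentiableWithinAt
    · intro t ht
      rw [interior_Ici] at ht
      have ht : 0 < t := ht
      rw [(hder t).deriv, ← inner_sub_left]
      have h1 := real_inner_le_norm (f' (x + t • d) - f' x) d
      have h2 := hf.2 (x + t • d) x
      rw [add_sub_cancel_left, norm_smul, Real.norm_of_nonneg ht.le] at h2
      have h3 := mul_le_mul_of_nonneg_right h2 (norm_nonneg d)
      nlinarith
  have h := hanti (show (0 : ℝ) ∈ Set.Ici 0 by simp) (show (1 : ℝ) ∈ Set.Ici 0 by simp)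
    zero_le_one
  have hy : x + d = y := by simp [hd]
  simp [hy] at h
  linarith

lemma aux_conv_s14 (f : Euc n → ℝ) (f' : Euc n → Euc n) (hf : ∀ x, HasGradientAt f (f' x) x)
    (hc : ConvexOn ℝ Set.univ f) (x y : Euc n) : f x + ⟪f' x, y - x⟫ ≤ f y := by
  have h1 := aux_line f f' hf x (y - x) 0
  have hcv : ConvexOn ℝ Set.univ (fun s : ℝ => f (x + s • (y - x))) := by
    have := hc.comp_affineMap (AffineMap.lineMap x y : ℝ →ᵃ[ℝ] Euc n)
    have he : (fun s : ℝ => f (x + s • (y - x)))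
        = f ∘ (AffineMap.lineMap x y : ℝ →ᵃ[ℝ] Euc n) := by
      funext s
      simp [AffineMap.lineMap_apply, add_comm]
    rw [he]
    simpa using this
  have h2 := hcv.le_slope_of_hasDerivAt (Set.mem_univ 0) (Set.mem_univ 1) one_pos h1
  simp [slope_def_field] at h2
  linarith

lemma aux_prox (s : Set (Euc n)) (h : Euc n → ℝ) (hc : ConvexOn ℝ s h) (eta : ℝ)
    (heta : 0 < eta) (x p : Euc n) (hp : IsProxPt s h eta x p) (y : Euc n) (hy : y ∈ s) :
    eta * h p + ⟪x - p, y - p⟫ ≤ eta * h y := by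
  have key : ∀ t : ℝ, 0 < t → t ≤ 1 →
      eta * h p + ⟪x - p, y - p⟫ - eta * h y ≤ t * (‖y - p‖ ^ 2 / 2) := by
    intro t ht ht1
    have hm := hc.1 hp.1 hy (show 0 ≤ 1 - t by linarith) ht.le (by ring)
    have h1 := hp.2 hm
    have h2 := hc.2 hp.1 hy (show 0 ≤ 1 - t by linarith) ht.le (by ring)
    simp only [smul_eq_mul] at h2
    have h3 : (1 - t) • p + t • y - x = t • (y - p) - (x - p) := by module
    have h4 : ‖p - x‖ = ‖x - p‖ := norm_sub_rev _ _
    rw [h3, h4, norm_sub_sq_real (t • (y - p)) (x - p), norm_smul, Real.norm_of_nonneg ht.le, real_inner_smul_left,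
      real_inner_comm (x - p) (y - p)] at h1
    have h5 := mul_le_mul_of_nonneg_left h2 heta.le
    have h6 : t * (eta * h p + ⟪x - p, y - p⟫ - eta * h y) ≤ t * (t * (‖y - p‖ ^ 2 / 2)) := by
      nlinarith
    exact le_of_mul_le_mul_left h6 ht
  by_contra hcon
  push Not at hcon
  set a := eta * h p + ⟪x - p, y - p⟫ - eta * h y with ha
  have hapos : 0 < a := by linarith
  set b := ‖y - p‖ ^ 2 / 2 with hb
  have hb0 : 0 ≤ b := by positivity
  have hpos : 0 < a + b + 1 := by linarith
  have hk := key (a / (a + b + 1)) (by positivity) (by rw [div_le_one hpos]; linarith)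
  rw [div_mul_eq_mul_div, le_div_iff₀ hpos] at hk
  nlinarith

lemma aux_nonexp (s : Set (Euc n)) (h : Euc n → ℝ) (hc : ConvexOn ℝ s h) (eta : ℝ)
    (heta : 0 < eta) (x p x' q : Euc n) (hp : IsProxPt s h eta x p)
    (hq : IsProxPt s h eta x' q) : ‖p - q‖ ≤ ‖x - x'‖ := by
  have h1 := aux_prox s h hc eta heta x p hp q hq.1
  have h2 := aux_prox s h hc eta heta x' q hq p hp.1
  have h3 : ⟪x - p, q - p⟫ + ⟪x' - q, p - q⟫ = ‖p - q‖ ^ 2 - ⟪x - x', p - q⟫ := by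
    rw [← real_inner_self_eq_norm_sq]
    simp only [inner_sub_left, inner_sub_right]
    ring
  have h4 := real_inner_le_norm (x - x') (p - q)
  by_contra hcon
  push Not at hcon
  have := norm_nonneg (x - x')
  nlinarith

theorem grad_map_lemma
    (domh : Set (Euc n)) (f h : Euc n → ℝ) (f' : Euc n → Euc n)
    (Lf D eta : ℝ)
    (hfconv : ConvexOn ℝ Set.univ f)
    (hfsmooth : HasLipGrad f f' Lf) (hLf : 0 < Lf)
    (hhconv : ConvexOn ℝ domh h) (hdomclosed : IsClosed domh)
    (hdomne : domh.Nonempty)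
    (hdiam : ∀ u ∈ domh, ∀ w ∈ domh, ‖u - w‖ ≤ D)
    (heta0 : 0 < eta) (heta : eta ≤ 1 / Lf)
    (xt p : Euc n) (hxt : xt ∈ domh)
    (hp : IsProxPt domh h eta (xt - eta • f' xt) p)
    (G : Euc n) (hG : G = eta⁻¹ • (xt - p))
    (xplus : Euc n) (hxplus : xplus = xt - eta • G)
    (phistar : ℝ) (hphistar : IsGLB ((fun u => f u + h u) '' domh) phistar) :
    -- (a)
    (f xplus + h xplus - phistar ≤ D * ‖G‖ - eta / 2 * ‖G‖ ^ 2) ∧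
    -- (b)
    (∀ eps : ℝ, ‖G‖ ≤ eps →
      ∃ v ∈ subdiffOn domh (fun u => f u + h u) xplus, ‖v‖ ≤ 2 * eps) ∧
    -- (c)
    (∀ eps gam : ℝ, ∀ xbar q : Euc n, 0 < gam → xbar ∈ domh →
      gam ≤ eps / (2 * D) →
      IsProxPt domh h eta (xt - eta • (f' xt + gam • (xt - xbar))) q →
      ‖eta⁻¹ • (xt - q)‖ ≤ eps / 2 →
      ‖G‖ ≤ eps) := by
  have hpG : xt - p = eta • G := by rw [hG, smul_smul, mul_inv_cancel₀ heta0.ne', one_smul]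
  have hxp : xplus = p := by rw [hxplus, ← hpG]; abel
  rw [hxp]
  have hLe : Lf * eta ≤ 1 := by
    rw [le_div_iff₀ hLf] at heta; linarith
  have hnorm : ‖p - xt‖ = eta * ‖G‖ := by
    rw [norm_sub_rev, hpG, norm_smul, Real.norm_of_nonneg heta0.le]
  have hprox : ∀ y ∈ domh, h p + ⟪G - f' xt, y - p⟫ ≤ h y := by
    intro y hy
    have h1 := aux_prox domh h hhconv eta heta0 _ p hp y hy
    have h2 : xt - eta • f' xt - p = eta • (G - f' xt) := by
      rw [smul_sub, ← hpG]; abel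
    rw [h2, real_inner_smul_left, ← mul_add] at h1
    exact le_of_mul_le_mul_left h1 heta0
  refine ⟨?_, ?_, ?_⟩
  · have hlb : f p + h p - (D * ‖G‖ - eta / 2 * ‖G‖ ^ 2) ∈
        lowerBounds ((fun u => f u + h u) '' domh) := by
      rintro _ ⟨y, hy, rfl⟩
      have h1 := aux_descent f f' Lf hfsmooth xt p
      have h2 := aux_conv_s14 f f' hfsmooth.1 hfconv xt y
      have h3 := hprox y hy
      have h4 : ⟪G, xt - y⟫ ≤ D * ‖G‖ := by
        have := real_inner_le_norm G (xt - y)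
        have := mul_le_mul_of_nonneg_left (hdiam xt hxt y hy) (norm_nonneg G)
        linarith
      have h5 : ⟪f' xt, p - xt⟫ - ⟪f' xt, y - xt⟫ - ⟪G - f' xt, y - p⟫
          = ⟪G, xt - y⟫ - ⟪G, xt - p⟫ := by
        simp only [inner_sub_left, inner_sub_right]
        ring
      have h6 : ⟪G, xt - p⟫ = eta * ‖G‖ ^ 2 := by
        rw [hpG, real_inner_smul_right, real_inner_self_eq_norm_sq]
      rw [hnorm] at h1
      have h7 : Lf / 2 * (eta * ‖G‖) ^ 2 ≤ eta / 2 * ‖G‖ ^ 2 := by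
        have := mul_le_mul_of_nonneg_right hLe (show 0 ≤ eta / 2 * ‖G‖ ^ 2 by positivity)
        nlinarith
      show _ ≤ f y + h y
      linarith
    have := hphistar.2 hlb
    linarith
  · intro eps heps
    refine ⟨G - f' xt + f' p, ?_, ?_⟩
    · intro y hy
      have h1 := hprox y hy
      have h2 := aux_conv_s14 f f' hfsmooth.1 hfconv p y
      show f p + h p + _ ≤ f y + h y
      rw [inner_add_left]
      linarith
    · have h1 : G - f' xt + f' p = G + (f' p - f' xt) := by abel
      rw [h1]
      have h2 := norm_add_le G (f' p - f' xt)
      have h3 := hfsmooth.2 p xt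
      rw [hnorm] at h3
      have := mul_le_mul_of_nonneg_right hLe (norm_nonneg G)
      linarith
  · intro eps gam xbar q hgam hxbar hle hq hqn
    have hD0 : 0 ≤ D := (norm_nonneg _).trans (hdiam xt hxt xt hxt)
    have hD : 0 < D := by
      rcases hD0.eq_or_lt with h0 | h0
      · rw [← h0] at hle; simp at hle; linarith
      · exact h0
    rw [le_div_iff₀ (by positivity)] at hle
    have h1 := aux_nonexp domh h hhconv eta heta0 _ _ _ _ hq hp
    have h2 : xt - eta • (f' xt + gam • (xt - xbar)) - (xt - eta • f' xt)
        = -((eta * gam) • (xt - xbar)) := by module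
    rw [h2, norm_neg, norm_smul, Real.norm_of_nonneg (by positivity)] at h1
    have h3 := mul_le_mul_of_nonneg_left (hdiam xt hxt xbar hxbar)
      (show 0 ≤ eta * gam by positivity)
    have h4 : G = eta⁻¹ • (xt - q) + eta⁻¹ • (q - p) := by rw [hG]; module
    have h5 := norm_add_le (eta⁻¹ • (xt - q)) (eta⁻¹ • (q - p))
    rw [← h4] at h5
    have h6 : ‖eta⁻¹ • (q - p)‖ ≤ gam * D := by
      rw [norm_smul, Real.norm_of_nonneg (by positivity), inv_mul_le_iff₀ heta0]
      linarith
    linarith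
end
end

section
/- Suppose (x,λ) is an ε-primal-dual solution to the linearly constrained problem, i.e., there exists v ∈ ∂_x L(·,λ)(x) with ‖v‖ ≤ ε and ‖Ax − b‖ ≤ ε. Then the absolute primal gap is bounded by |φ(x) − φ̂_*| ≤ ε·max{‖λ_*‖, ‖λ‖ + D}, where λ_* is any optimal dual solution (maximizer of d) and φ̂_* is the optimal value. -/
noncomputable section

open Set
open scoped RealInnerProductSpace BigOperators

variable {n m : ℕ}

/-!
STATEMENT 16 (Lemma: an ε-primal-dual solution has absolute primal gap at most
`ε · max{‖λ_*‖, ‖λ‖ + D}`).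
-/

theorem pd_gap
    (domh : Set (Euc n)) (f h : Euc n → ℝ) (f' : Euc n → Euc n)
    (A : Euc n →L[ℝ] Euc m) (bvec : Euc m)
    (Lf D eps : ℝ)
    (hfconv : ConvexOn ℝ Set.univ f)
    (hfsmooth : HasLipGrad f f' Lf)
    (hhconv : ConvexOn ℝ domh h)
    (hdiam : ∀ u ∈ domh, ∀ w ∈ domh, ‖u - w‖ ≤ D)
    (heps : 0 ≤ eps)
    -- the Lagrangian dual, with attained inner minimum
    (d : Euc m → ℝ)
    (hd : ∀ lam : Euc m,
        IsLeast ((fun x => f x + h x + ⟪lam, A x - bvec⟫) '' domh) (d lam))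
    -- primal optimum `xstar` with value `phistar`, and a dual maximizer `lamstar`
    (xstar : Euc n) (phistar : ℝ) (lamstar : Euc m)
    (hxstar : xstar ∈ domh) (hxstarfeas : A xstar = bvec)
    (hphistar : phistar = f xstar + h xstar)
    (hopt : ∀ u ∈ domh, A u = bvec → phistar ≤ f u + h u)
    (hlamstar : ∀ nu : Euc m, d nu ≤ d lamstar)
    -- strong duality
    (hstrongdual : d lamstar = phistar)
    -- `(x, lam)` is an ε-primal-dual solution
    (x : Euc n) (lam : Euc m) (hx : x ∈ domh)
    (hsol : ∃ v ∈ subdiffOn domh (fun u => f u + h u + ⟪lam, A u - bvec⟫) x, ‖v‖ ≤ eps)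
    (hfeas : ‖A x - bvec‖ ≤ eps) :
    |f x + h x - phistar| ≤ eps * max ‖lamstar‖ (‖lam‖ + D) := by
  obtain ⟨v, hv, hve⟩ := hsol
  have h1 : f x + h x + ⟪lam, A x - bvec⟫ + ⟪v, xstar - x⟫
      ≤ f xstar + h xstar + ⟪lam, A xstar - bvec⟫ := hv xstar hxstar
  rw [hxstarfeas, sub_self, inner_zero_right, add_zero, ← hphistar] at h1
  have h2 : d lamstar ≤ f x + h x + ⟪lamstar, A x - bvec⟫ :=
    (hd lamstar).2 ⟨x, hx, rfl⟩
  rw [hstrongdual] at h2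
  have h3 : ⟪lamstar, A x - bvec⟫ ≤ ‖lamstar‖ * eps :=
    (real_inner_le_norm _ _).trans (mul_le_mul_of_nonneg_left hfeas (norm_nonneg _))
  have h4 : |⟪lam, A x - bvec⟫| ≤ ‖lam‖ * eps :=
    (abs_real_inner_le_norm _ _).trans (mul_le_mul_of_nonneg_left hfeas (norm_nonneg _))
  have h5 : |⟪v, xstar - x⟫| ≤ eps * D :=
    (abs_real_inner_le_norm _ _).trans
      (mul_le_mul hve (hdiam _ hxstar _ hx) (norm_nonneg _) heps)
  have h6 : eps * ‖lamstar‖ ≤ eps * max ‖lamstar‖ (‖lam‖ + D) :=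
    mul_le_mul_of_nonneg_left (le_max_left _ _) heps
  have h7 : eps * (‖lam‖ + D) ≤ eps * max ‖lamstar‖ (‖lam‖ + D) :=
    mul_le_mul_of_nonneg_left (le_max_right _ _) heps
  have h8 := (abs_le.1 h4).1
  have h9 := (abs_le.1 h5).1
  rw [abs_le]
  constructor <;> linarith
end
end

section
/- Let λ > 0, μ ≥ 0, and define scalar sequences by B_0 = 0, τ_0 = 1, and for k ≥ 0: b_k = (λτ_k + √(λ²τ_k² + 4λτ_k B_k))/2, B_{k+1} = B_k + b_k, τ_{k+1} = τ_k + b_k μ. Then for every k ≥ 0: (a) b_k² = τ_k λ B_{k+1}; (b) τ_k = 1 + μB_k; (c) B_{k+1} ≥ λ·max{ (k+1)²/4, (1 + √(λμ)/2)^{2k} }; and (d) for any α satisfying 0 ≤ α < (1+√(λμ))⁻², the sum C = Σ_{i=0}^∞ B_{i+1} α^i is finite and satisfies C ≤ λ/(1−β)⁴ where β = √α(1+√(λμ)) < 1. -/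
/-!
STATEMENT 17 (Lemma on FLOrA accelerated scalar sequences).
-/

noncomputable section

theorem flora_scalar_sequences
    (lam mu : ℝ) (hlam : 0 < lam) (hmu : 0 ≤ mu)
    (b B tau : ℕ → ℝ)
    (hB0 : B 0 = 0) (htau0 : tau 0 = 1)
    (hb : ∀ k, b k = (lam * tau k +
        Real.sqrt (lam ^ 2 * tau k ^ 2 + 4 * lam * tau k * B k)) / 2)
    (hB : ∀ k, B (k + 1) = B k + b k)
    (htau : ∀ k, tau (k + 1) = tau k + b k * mu) :
    ∀ k : ℕ,
      (b k ^ 2 = tau k * lam * B (k + 1)) ∧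
      (tau k = 1 + mu * B k) ∧
      (B (k + 1) ≥ lam * max (((k : ℝ) + 1) ^ 2 / 4)
          ((1 + Real.sqrt (lam * mu) / 2) ^ (2 * k))) ∧
      (∀ alpha : ℝ, 0 ≤ alpha → alpha < ((1 + Real.sqrt (lam * mu)) ^ 2)⁻¹ →
        Real.sqrt alpha * (1 + Real.sqrt (lam * mu)) < 1 ∧
        Summable (fun i : ℕ => B (i + 1) * alpha ^ i) ∧
        (∑' i : ℕ, B (i + 1) * alpha ^ i) ≤
          lam / (1 - Real.sqrt alpha * (1 + Real.sqrt (lam * mu))) ^ 4) := by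
  have hT : ∀ k, tau k = 1 + mu * B k := by
    intro k
    induction k with
    | zero => rw [hB0, htau0]; ring
    | succ n ih => rw [htau, hB, ih]; ring
  have hBn : ∀ k, 0 ≤ B k := by
    intro k
    induction k with
    | zero => rw [hB0]
    | succ n ih =>
      have h1 : 0 ≤ tau n := by rw [hT]; positivity
      rw [hB, hb]; positivity
  have hTp : ∀ k, 0 < tau k := by
    intro k
    have := hBn k
    rw [hT]; positivity
  have hA : ∀ k, b k ^ 2 = tau k * lam * B (k + 1) := by
    intro k
    have h1 := hTp k
    have h2 := hBn k
    have h3 := Real.sq_sqrt (show 0 ≤ lam ^ 2 * tau k ^ 2 + 4 * lam * tau k * B k by positivity)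
    rw [hB, hb]
    linear_combination h3 / 4
  have hbp : ∀ k, 0 < b k := by
    intro k
    have h1 := hTp k
    rw [hb]; positivity
  obtain ⟨s, hs⟩ : ∃ s, s = Real.sqrt (lam * mu) := ⟨_, rfl⟩
  obtain ⟨l, hl⟩ : ∃ l, l = Real.sqrt lam := ⟨_, rfl⟩
  have hs0 : 0 ≤ s := hs ▸ Real.sqrt_nonneg _
  have hl0 : 0 < l := hl ▸ Real.sqrt_pos.2 hlam
  have hs2 : s ^ 2 = lam * mu := by rw [hs]; exact Real.sq_sqrt (by positivity)
  have hl2 : l ^ 2 = lam := by rw [hl]; exact Real.sq_sqrt hlam.le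
  rw [← hs]
  obtain ⟨r, hr⟩ : ∃ r : ℕ → ℝ, ∀ k, r k = Real.sqrt (B k) := ⟨_, fun _ => rfl⟩
  have hr0 : ∀ k, 0 ≤ r k := fun k => hr k ▸ Real.sqrt_nonneg _
  have hr2 : ∀ k, r k ^ 2 = B k := fun k => by rw [hr]; exact Real.sq_sqrt (hBn k)
  have key : ∀ k, r k + l / 2 ≤ r (k+1) ∧ (1 + s / 2) * r k ≤ r (k+1) ∧
      r (k+1) ≤ (1 + s) * r k + l := by
    intro k
    obtain ⟨q, hq⟩ : ∃ q, q = Real.sqrt (lam * tau k) := ⟨_, rfl⟩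
    have hq0 : 0 ≤ q := hq ▸ Real.sqrt_nonneg _
    have hq2 : q ^ 2 = lam * tau k := by
      rw [hq]; exact Real.sq_sqrt (mul_nonneg hlam.le (hTp k).le)
    have hq3 : q ^ 2 = l ^ 2 + (s * r k) ^ 2 := by
      rw [hq2, mul_pow, hs2, hr2, hl2, hT]; ring
    have hR := hr0 k
    have hR' := hr0 (k+1)
    have hsr : 0 ≤ s * r k := mul_nonneg hs0 hR
    have hbq : b k = q * r (k+1) := by
      rw [← sq_eq_sq₀ (hbp k).le (by positivity), hA, mul_pow, hr2, hq2]; ring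
    have hquad : r (k+1) ^ 2 = r k ^ 2 + q * r (k+1) := by
      rw [hr2, hr2, hB, hbq]
    have hq4 : l ≤ q := abs_le_of_sq_le_sq' (by nlinarith) hq0 |>.2
    have hq5 : s * r k ≤ q := abs_le_of_sq_le_sq' (by nlinarith) hq0 |>.2
    have hq6 : q ≤ l + s * r k := abs_le_of_sq_le_sq' (by nlinarith) (by positivity) |>.2
    have hpos : 0 < r (k+1) := by
      rcases hR'.lt_or_eq with h | h
      · exact h
      · have := hbp k
        rw [hbq, ← h] at this; simp at this
    have hge : q ≤ r (k+1) := by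
      by_contra h
      push Not at h
      nlinarith [sq_nonneg (r k)]
    have e : (r (k+1) - q / 2) ^ 2 = r k ^ 2 + q ^ 2 / 4 := by linear_combination hquad
    have lo : r k ≤ r (k+1) - q / 2 :=
      (abs_le_of_sq_le_sq' (by rw [e]; nlinarith) (by linarith)).2
    have up : r (k+1) - q / 2 ≤ r k + q / 2 :=
      (abs_le_of_sq_le_sq' (by rw [e]; nlinarith) (by linarith)).2
    refine ⟨by linarith, by linarith, by linarith⟩
  have hr00 : r 0 = 0 := by rw [hr, hB0, Real.sqrt_zero]
  have hB1 : B 1 = lam := by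
    rw [show (1:ℕ) = 0 + 1 from rfl, hB, hb, hB0, htau0]
    simp [Real.sqrt_sq hlam.le]
  have hr1 : r 1 = l := by rw [hr, hB1, hl]
  have L1 : ∀ k : ℕ, l * ((k : ℝ) / 2) ≤ r k := by
    intro k
    induction k with
    | zero => simp [hr00]
    | succ n ih => have := (key n).1; push_cast; linarith
  have L2 : ∀ k : ℕ, l * (1 + s / 2) ^ k ≤ r (k + 1) := by
    intro k
    induction k with
    | zero => simp [hr1]
    | succ n ih =>
      refine le_trans ?_ (key (n+1)).2.1
      rw [pow_succ]
      nlinarith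
  have L3 : ∀ k : ℕ, r (k + 1) ≤ l * (((k : ℝ) + 1) * (1 + s) ^ k) := by
    intro k
    induction k with
    | zero => simp [hr1]
    | succ n ih =>
      refine le_trans (key (n+1)).2.2 ?_
      have h1 : (1:ℝ) ≤ (1 + s) ^ (n+1) := one_le_pow₀ (by linarith)
      have h2 := mul_le_mul_of_nonneg_left ih (show 0 ≤ 1 + s by linarith)
      have h3 := mul_le_mul_of_nonneg_left h1 hl0.le
      push_cast
      calc (1 + s) * r (n+1) + l ≤ (1 + s) * (l * (((n : ℝ) + 1) * (1 + s) ^ n)) +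
            l * (1 + s) ^ (n+1) := by linarith
        _ = _ := by ring
  intro k
  refine ⟨hA k, hT k, ?_, ?_⟩
  · rw [ge_iff_le, mul_max_of_nonneg _ _ hlam.le, ← hr2 (k+1)]
    apply max_le
    · have h := pow_le_pow_left₀ (by positivity) (L1 (k+1)) 2
      refine le_trans (le_of_eq ?_) h
      rw [mul_pow, hl2]; push_cast; ring
    · have h := pow_le_pow_left₀ (by positivity) (L2 k) 2
      refine le_trans (le_of_eq ?_) h
      rw [mul_pow, hl2, ← pow_mul, mul_comm k 2]
  · intro a ha0 ha
    obtain ⟨β, hβ⟩ : ∃ β, β = Real.sqrt a * (1 + s) := ⟨_, rfl⟩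
    rw [← hβ]
    have hβ0 : 0 ≤ β := by rw [hβ]; positivity
    have hβ2 : β ^ 2 = a * (1 + s) ^ 2 := by rw [hβ, mul_pow, Real.sq_sqrt ha0]
    have hx1 : β ^ 2 < 1 := by
      rw [hβ2]
      have hp : 0 < (1 + s) ^ 2 := by positivity
      have h := mul_lt_mul_of_pos_right ha hp
      rwa [inv_mul_cancel₀ hp.ne'] at h
    have hβ1 : β < 1 := by nlinarith
    have hS := (hasSum_choose_mul_geometric_of_norm_lt_one 3
      (show ‖β ^ 2‖ < 1 by rw [Real.norm_of_nonneg (by positivity)]; exact hx1)).mul_left lam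
    have hle : ∀ i : ℕ, B (i+1) * a ^ i ≤ lam * (((i + 3).choose 3 : ℕ) * (β ^ 2) ^ i) := by
      intro i
      have h := pow_le_pow_left₀ (hr0 _) (L3 i) 2
      have hc : ((i : ℝ) + 1) ^ 2 ≤ ((i + 3).choose 3 : ℕ) := by
        have h6 : (i + 3).choose 3 * 6 = (i+1) * (i+2) * (i+3) := by
          have := Nat.descFactorial_eq_factorial_mul_choose (i+3) 3
          simp [Nat.descFactorial, Nat.factorial] at this
          linarith
        have h7 : (((i + 3).choose 3 : ℕ) : ℝ) * 6 = (i+1) * (i+2) * (i+3) := by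
          exact_mod_cast h6
        have h8 : (i : ℝ) ≤ i ^ 2 := by exact_mod_cast Nat.le_self_pow (by norm_num) i
        have h9 : (0:ℝ) ≤ i := by positivity
        nlinarith [mul_nonneg (sub_nonneg.2 h8) (show (0:ℝ) ≤ i + 1 by positivity)]
      rw [hr2] at h
      calc B (i+1) * a ^ i ≤ (l * (((i : ℝ) + 1) * (1 + s) ^ i)) ^ 2 * a ^ i := by gcongr
        _ = lam * (((i : ℝ) + 1) ^ 2 * (β ^ 2) ^ i) := by
          rw [hβ2, ← hl2, mul_pow a, pow_right_comm]; ring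
        _ ≤ _ := by gcongr
    have hsum : Summable (fun i : ℕ => B (i + 1) * a ^ i) :=
      Summable.of_nonneg_of_le (fun i => mul_nonneg (hBn _) (by positivity)) hle hS.summable
    refine ⟨hβ1, hsum, (hasSum_le hle hsum.hasSum hS).trans ?_⟩
    have h1 : 0 < 1 - β := by linarith
    have h2 : 1 - β ≤ 1 - β ^ 2 := by nlinarith
    rw [mul_one_div]
    norm_num
    gcongr
end
end

section
/- In the LOrA framework with 𝒜_k = ∞ at all iterations, let X_* be the (nonempty) set of minimizers of Φ and x_* = argmin{‖x_0 − x‖ : x ∈ X_*}. Then for every k ≥ 0: (i) 2λ[Φ(y_{k+1}) − Φ(x_*)] + (1−σ)‖y_{k+1} − x_k‖² ≤ ‖x_k − x_*‖² − ‖x_{k+1} − x_*‖² + 2λδ_k; and (ii) if the tolerances are summable with C_δ = Σ_{i=0}^∞ δ_i < ∞, then ‖x_k − x_*‖ ≤ R_0 + √(2λC_δ) for every k ≥ 0, where R_0 = ‖x_0 − x_*‖. -/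
noncomputable section

open Set
open scoped RealInnerProductSpace BigOperators

variable {n m : ℕ}

/-!
STATEMENT 18 (Lemma: single-step estimate and uniform iterate bound for LOrA with `𝒜_k = ∞`).
-/

theorem lora_single_step_and_distance_bound
    (domPhi : Set (Euc n)) (Phi : Euc n → ℝ) (Gam : ℕ → Euc n → ℝ)
    (sigma lam : ℝ) (delta : ℕ → ℝ)
    (hsigma0 : 0 < sigma) (hsigma1 : sigma < 1) (hlam : 0 < lam)
    (hdelta : ∀ k, 0 < delta k)
    (hPhiconv : ConvexOn ℝ domPhi Phi)
    (hPhilsc : LowerSemicontinuousOn Phi domPhi)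
    (x y : ℕ → Euc n)
    (hy0 : y 0 = x 0) (hx0 : x 0 ∈ domPhi)
    (hymem : ∀ k, y (k + 1) ∈ domPhi) (hxmem : ∀ k, x (k + 1) ∈ domPhi)
    (hGamsc : ∀ k, SCOn domPhi (1 / lam) (Gam k))
    (hGamle : ∀ k, ∀ z ∈ domPhi, Gam k z ≤ Phi z + ‖z - x k‖ ^ 2 / (2 * lam))
    -- `𝒜_k = ∞` at all iterations: `x_{k+1}` minimizes `Γ_k` and `û_{k+1} = 0`
    (hxmin : ∀ k, ∀ z ∈ domPhi, Gam k (x (k + 1)) ≤ Gam k z)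
    -- inexactness condition (with `û_{k+1} = 0`)
    (hineq : ∀ k,
        2 * lam * (Phi (y (k + 1)) + ‖y (k + 1) - x k‖ ^ 2 / (2 * lam) -
          Gam k (x (k + 1))) ≤
        sigma * ‖y (k + 1) - x k‖ ^ 2 + 2 * lam * delta k)
    -- `xstar = argmin{‖x 0 - x‖ : x ∈ X_*}` and `R0 = ‖x 0 - xstar‖`
    (xstar : Euc n) (R0 : ℝ)
    (hxstar : xstar ∈ domPhi) (hxstarmin : ∀ z ∈ domPhi, Phi xstar ≤ Phi z)
    (hR0 : R0 = ‖x 0 - xstar‖)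
    (hxstarmindist : ∀ z ∈ domPhi, (∀ u ∈ domPhi, Phi z ≤ Phi u) → R0 ≤ ‖x 0 - z‖) :
    ∀ k : ℕ,
      (2 * lam * (Phi (y (k + 1)) - Phi xstar) +
          (1 - sigma) * ‖y (k + 1) - x k‖ ^ 2 ≤
        ‖x k - xstar‖ ^ 2 - ‖x (k + 1) - xstar‖ ^ 2 + 2 * lam * delta k) ∧
      (Summable delta →
        ‖x k - xstar‖ ≤ R0 + Real.sqrt (2 * lam * (∑' i : ℕ, delta i))) := by
  have step : ∀ k, 2 * lam * (Phi (y (k + 1)) - Phi xstar) +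
          (1 - sigma) * ‖y (k + 1) - x k‖ ^ 2 ≤
        ‖x k - xstar‖ ^ 2 - ‖x (k + 1) - xstar‖ ^ 2 + 2 * lam * delta k := by
    intro k
    have key : ‖x (k + 1) - xstar‖ ^ 2 / (2 * lam) ≤ Gam k xstar - Gam k (x (k + 1)) := by
      have hG := hxmin k xstar hxstar
      have h : ∀ t : ℝ, 0 < t → t < 1 →
          (1 - t) * (‖x (k + 1) - xstar‖ ^ 2 / (2 * lam)) ≤ Gam k xstar - Gam k (x (k + 1)) := by
        intro t h0 h1
        have e1 := hGamsc k (hxmem k) hxstar (a := 1 - t) (c := t) (by linarith) h0.le (by ring)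
        have e2 := hxmin k _ (hPhiconv.1 (hxmem k) hxstar
          (by linarith : 0 ≤ 1 - t) h0.le (by ring))
        have e3 : 1 / lam / 2 * ((1 - t) * t) * ‖x (k + 1) - xstar‖ ^ 2
            = t * ((1 - t) * (‖x (k + 1) - xstar‖ ^ 2 / (2 * lam))) := by
          field_simp
        rw [e3] at e1
        refine le_of_mul_le_mul_left ?_ h0
        linarith
      generalize ‖x (k + 1) - xstar‖ ^ 2 / (2 * lam) = D at h ⊢
      by_contra hc
      push Not at hc
      have hD : 0 < D := by linarith
      have h2 := h ((D - (Gam k xstar - Gam k (x (k + 1)))) / (2 * D))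
        (div_pos (by linarith) (by linarith)) (by rw [div_lt_one (by linarith)]; linarith)
      have h3 : (1 - (D - (Gam k xstar - Gam k (x (k + 1)))) / (2 * D)) * D
          = (D + (Gam k xstar - Gam k (x (k + 1)))) / 2 := by
        field_simp
        ring
      linarith
    have a1 := hGamle k xstar hxstar
    have a2 := hineq k
    have a3 : ‖x (k + 1) - xstar‖ ^ 2 / (2 * lam) + Gam k (x (k + 1)) - Phi xstar ≤
        ‖xstar - x k‖ ^ 2 / (2 * lam) := by linarith
    have a4 := mul_le_mul_of_nonneg_left a3 (by linarith : 0 ≤ 2 * lam)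
    have c : ∀ r : ℝ, 2 * lam * (r / (2 * lam)) = r := fun r => by field_simp
    rw [mul_sub, mul_add, c, c, norm_sub_rev xstar] at a4
    rw [mul_sub, mul_add, c] at a2
    linarith
  have sumb : ∀ k, ‖x k - xstar‖ ^ 2 ≤ R0 ^ 2 + 2 * lam * ∑ i ∈ Finset.range k, delta i := by
    intro k
    induction k with
    | zero => simp [hR0]
    | succ k ih =>
      rw [Finset.sum_range_succ]
      have s1 := step k
      have s2 : 0 ≤ 2 * lam * (Phi (y (k + 1)) - Phi xstar) :=
        mul_nonneg (by linarith) (by linarith [hxstarmin _ (hymem k)])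
      have s3 : 0 ≤ (1 - sigma) * ‖y (k + 1) - x k‖ ^ 2 :=
        mul_nonneg (by linarith) (by positivity)
      linarith
  intro k
  refine ⟨step k, fun hs => ?_⟩
  have hR : 0 ≤ R0 := by rw [hR0]; positivity
  have t1 : ∑ i ∈ Finset.range k, delta i ≤ ∑' i, delta i :=
    hs.sum_le_tsum _ (fun i _ => (hdelta i).le)
  have t0 : 0 ≤ ∑' i, delta i := tsum_nonneg (fun i => (hdelta i).le)
  have t2 := mul_le_mul_of_nonneg_left t1 (by linarith : 0 ≤ 2 * lam)
  have t3 : 0 ≤ 2 * lam * ∑' i, delta i := mul_nonneg (by linarith) t0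
  have t4 := Real.sq_sqrt t3
  have t5 := Real.sqrt_nonneg (2 * lam * ∑' i, delta i)
  refine abs_le_of_sq_le_sq' ?_ (by linarith) |>.2
  nlinarith [sumb k, mul_nonneg hR t5]
end
end

section
/- In the FLOrA framework, suppose y_k = ỹ_k at every iteration, σ < 1, and x_0 = 0. Let X_* be the (nonempty) set of minimizers of Φ, R_0 = min{‖x_0 − x‖ : x ∈ X_*} with x_* attaining this minimum, and R̄_0 = max{1, R_0}. Then for every k ≥ 0, the prox centers satisfy ‖x̃_k − x_*‖ ≤ 𝓡_F, where 𝓡_F = R̄_0·(1 + √(2δ_0 C_F))·(2/√(1−σ) + 1) and C_F = Σ_{i=0}^∞ B_{i+1} α^i. -/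
noncomputable section

open Set
open scoped RealInnerProductSpace BigOperators

variable {n m : ℕ}

/-!
STATEMENT 19 (Lemma: uniform bound on the distance from the FLOrA prox centers to the
minimum-distance optimal solution, when `y_k = ỹ_k`, `σ < 1` and `x_0 = 0`).
-/


lemma aux_limit (X K : ℝ) (h : ∀ t : ℝ, 0 < t → t ≤ 1 → 0 ≤ X + t * K) : 0 ≤ X := by
  by_contra hX
  push Not at hX
  have hK : 0 < |K| + 1 := by positivity
  have h1 : 0 < min 1 (-X / (2 * (|K| + 1))) := lt_min one_pos (by apply div_pos <;> linarith)
  have h2 := h _ h1 (min_le_left _ _)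
  have h3 : min 1 (-X / (2 * (|K| + 1))) * (|K| + 1) ≤ -X / 2 := by
    calc _ ≤ (-X / (2 * (|K| + 1))) * (|K| + 1) := by
          apply mul_le_mul_of_nonneg_right (min_le_right _ _) hK.le
      _ = -X / 2 := by field_simp
  nlinarith [le_abs_self K]

lemma aux_min (s : Set (Euc n)) (hs : Convex ℝ s) (f : Euc n → ℝ) (m c : ℝ)
    (hf : SCOn s m f) (z p : Euc n) (hz : z ∈ s)
    (hmin : ∀ w ∈ s, f z + c * ‖z - p‖ ^ 2 ≤ f w + c * ‖w - p‖ ^ 2) (w : Euc n) (hw : w ∈ s) :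
    f z + 2 * c * ⟪p - z, w - z⟫ + m / 2 * ‖w - z‖ ^ 2 ≤ f w := by
  have key := aux_limit (f w - f z - m / 2 * ‖w - z‖ ^ 2 - 2 * c * ⟪p - z, w - z⟫)
    ((m / 2 + c) * ‖w - z‖ ^ 2) ?_
  · linarith
  intro t ht0 ht1
  have h1 := hf hz hw (sub_nonneg.2 ht1) ht0.le (by ring)
  have h2 := hmin _ (hs hz hw (sub_nonneg.2 ht1) ht0.le (by ring))
  have e : (1 - t) • z + t • w - p = (z - p) + t • (w - z) := by module
  have e2 : ‖(1 - t) • z + t • w - p‖ ^ 2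
      = ‖z - p‖ ^ 2 - 2 * t * ⟪p - z, w - z⟫ + t ^ 2 * ‖w - z‖ ^ 2 := by
    rw [e, norm_add_sq_real, inner_smul_right, norm_smul, mul_pow, Real.norm_eq_abs, sq_abs,
      ← neg_sub p z, inner_neg_left, norm_neg]
    ring
  rw [e2] at h2
  rw [norm_sub_rev z w] at h1
  have : 0 ≤ t * (f w - f z - m / 2 * ‖w - z‖ ^ 2 - 2 * c * ⟪p - z, w - z⟫ +
      t * ((m / 2 + c) * ‖w - z‖ ^ 2)) := by nlinarith
  exact nonneg_of_mul_nonneg_right this ht0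

def gamq (c mu : ℝ) (u z v : Euc n) : ℝ := c + ⟪u, v - z⟫ + mu / 2 * ‖v - z‖ ^ 2

lemma aux_prox_s19 (lam mu G : ℝ) (hlam : 0 < lam) (uh u z p v : Euc n)
    (hu : u = uh + lam⁻¹ • (p - z)) :
    gamq (G - ‖z - p‖ ^ 2 / (2 * lam)) mu u z v + ‖v - p‖ ^ 2 / (2 * lam)
      = G + ⟪uh, v - z⟫ + (mu + 1 / lam) / 2 * ‖v - z‖ ^ 2 := by
  have e : v - p = (v - z) - (p - z) := by abel
  have e2 : ‖v - p‖ ^ 2 = ‖v - z‖ ^ 2 - 2 * ⟪p - z, v - z⟫ + ‖z - p‖ ^ 2 := by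
    rw [e, norm_sub_sq_real, real_inner_comm, norm_sub_rev z p]
  unfold gamq
  rw [e2, hu, inner_add_left, inner_smul_left]
  simp only [RCLike.conj_to_real]
  field_simp
  ring

lemma aux_low (lam mu G : ℝ) (hlam : 0 < lam) (hmu : 0 ≤ mu) (uh r : Euc n) :
    G - ‖lam • uh‖ ^ 2 / (2 * lam) ≤ G + ⟪uh, r⟫ + (mu + 1 / lam) / 2 * ‖r‖ ^ 2 := by
  have h := sq_nonneg ‖lam • uh + r‖
  rw [norm_add_sq_real, inner_smul_left] at h
  simp only [RCLike.conj_to_real] at h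
  have h1 : 0 ≤ mu / 2 * ‖r‖ ^ 2 := by positivity
  have h2 : G + ⟪uh, r⟫ + (mu + 1 / lam) / 2 * ‖r‖ ^ 2 - (G - ‖lam • uh‖ ^ 2 / (2 * lam))
     = mu / 2 * ‖r‖ ^ 2 + (‖lam • uh‖ ^ 2 + 2 * (lam * ⟪uh, r⟫) + ‖r‖ ^ 2) / (2 * lam) := by
    field_simp
    ring
  have h3 := div_nonneg h (by positivity : 0 ≤ 2 * lam)
  linarith

lemma aux_three_s19 (c mu b t : ℝ) (u z w x xp : Euc n)
    (h : (t + b * mu) • xp = t • x + (b * mu) • z - b • u) :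
    b * gamq c mu u z w + t / 2 * ‖w - x‖ ^ 2 =
    b * gamq c mu u z xp + t / 2 * ‖xp - x‖ ^ 2 + (t + b * mu) / 2 * ‖w - xp‖ ^ 2 := by
  have hbu : b • u = t • (x - xp) + (b * mu) • (z - xp) := by
    have : b • u = t • x + (b * mu) • z - (t + b * mu) • xp := by rw [h]; abel
    rw [this]; module
  have hi : ∀ v : Euc n, b * ⟪u, v⟫ = t * ⟪x - xp, v⟫ + b * mu * ⟪z - xp, v⟫ := by
    intro v
    have := congrArg (fun q => ⟪q, v⟫) hbu
    simpa [inner_add_left, inner_smul_left] using this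
  unfold gamq
  have h1 := hi (w - z)
  have h2 := hi (xp - z)
  simp only [← real_inner_self_eq_norm_sq]
  rw [mul_add, mul_add, h1, mul_add, mul_add, h2]
  simp only [inner_sub_left, inner_sub_right]
  rw [real_inner_comm w x, real_inner_comm w xp, real_inner_comm w z, real_inner_comm x xp,
    real_inner_comm xp z]
  ring

lemma aux_conv_s19 (c mu a d : ℝ) (ha : 0 ≤ a) (hd : 0 ≤ d) (had : a + d = 1) (hmu : 0 ≤ mu)
    (u z p q : Euc n) :
    gamq c mu u z (a • p + d • q) ≤ a * gamq c mu u z p + d * gamq c mu u z q := by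
  have e : a • p + d • q - z = a • (p - z) + d • (q - z) := by
    have : z = (a + d) • z := by rw [had, one_smul]
    nth_rewrite 1 [this]
    module
  unfold gamq
  rw [e]
  have h := sq_nonneg ‖(p - z) - (q - z)‖
  rw [norm_sub_sq_real] at h
  rw [norm_add_sq_real, inner_add_right]
  simp only [inner_smul_left, inner_smul_right, norm_smul, RCLike.conj_to_real, mul_pow,
    Real.norm_eq_abs, sq_abs]
  obtain rfl : d = 1 - a := by linarith
  have := mul_nonneg (mul_nonneg (mul_nonneg ha hd) hmu) h
  nlinarith

lemma aux_step_s19 (lam mu sigma G dk b B Bp t Py Pw Pyt : ℝ) (hlam : 0 < lam) (hmu : 0 ≤ mu)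
    (uh u z p w x xp y yt : Euc n) (hb : 0 < b) (hB : 0 ≤ B) (hBp : Bp = B + b)
    (hb2 : b ^ 2 = lam * t * Bp)
    (hu : u = uh + lam⁻¹ • (p - z))
    (hp : p = (B / Bp) • y + (b / Bp) • x)
    (h : (t + b * mu) • xp = t • x + (b * mu) • z - b • u)
    (hPy : G + ⟪uh, y - z⟫ + (mu + 1 / lam) / 2 * ‖y - z‖ ^ 2 ≤ Py + ‖y - p‖ ^ 2 / (2 * lam))
    (hPw : G + ⟪uh, w - z⟫ + (mu + 1 / lam) / 2 * ‖w - z‖ ^ 2 ≤ Pw + ‖w - p‖ ^ 2 / (2 * lam))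
    (hin : ‖lam • uh‖ ^ 2 + 2 * lam * (Pyt + ‖yt - p‖ ^ 2 / (2 * lam) - G) ≤
        sigma * ‖yt - p‖ ^ 2 + 2 * lam * dk) :
    Bp * (Pyt - Pw) + (t + b * mu) / 2 * ‖w - xp‖ ^ 2
      + Bp * ((1 - sigma) / (2 * lam) * ‖yt - p‖ ^ 2) ≤
    B * (Py - Pw) + t / 2 * ‖w - x‖ ^ 2 + Bp * dk := by
  have hBp0 : 0 < Bp := by linarith
  rw [← aux_prox_s19 lam mu G hlam uh u z p _ hu] at hPy hPw
  have h3 := aux_three_s19 (G - ‖z - p‖ ^ 2 / (2 * lam)) mu b t u z w x xp h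
  have h4 := aux_conv_s19 (G - ‖z - p‖ ^ 2 / (2 * lam)) mu (B / Bp) (b / Bp) (by positivity)
    (by positivity) (by rw [hBp] at *; field_simp) hmu u z y xp
  have h5 := aux_prox_s19 lam mu G hlam uh u z p ((B / Bp) • y + (b / Bp) • xp) hu
  have h6 := aux_low lam mu G hlam hmu uh ((B / Bp) • y + (b / Bp) • xp - z)
  rw [← h5] at h6
  have e : (B / Bp) • y + (b / Bp) • xp - p = (b / Bp) • (xp - x) := by rw [hp]; module
  have e2 : Bp * (‖(B / Bp) • y + (b / Bp) • xp - p‖ ^ 2 / (2 * lam)) = t / 2 * ‖xp - x‖ ^ 2 := by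
    rw [e, norm_smul, mul_pow, Real.norm_eq_abs, sq_abs, div_pow, hb2]
    field_simp
  have h4' := mul_le_mul_of_nonneg_left h4 hBp0.le
  have h6' := mul_le_mul_of_nonneg_left h6 hBp0.le
  have e4 : ∀ r s : ℝ, Bp * (B / Bp * r + b / Bp * s) = B * r + b * s := by
    intro r s; field_simp
  rw [e4] at h4'
  rw [mul_add, e2] at h6'
  have h7 : Pyt + (1 - sigma) / (2 * lam) * ‖yt - p‖ ^ 2 - dk ≤ G - ‖lam • uh‖ ^ 2 / (2 * lam) := by
    have := div_le_div_of_nonneg_right hin (by positivity : 0 ≤ 2 * lam)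
    have e7 : (‖lam • uh‖ ^ 2 + 2 * lam * (Pyt + ‖yt - p‖ ^ 2 / (2 * lam) - G)) / (2 * lam)
      = ‖lam • uh‖ ^ 2 / (2 * lam) + Pyt + ‖yt - p‖ ^ 2 / (2 * lam) - G := by field_simp; ring
    have e8 : (sigma * ‖yt - p‖ ^ 2 + 2 * lam * dk) / (2 * lam)
      = sigma / (2 * lam) * ‖yt - p‖ ^ 2 + dk := by field_simp
    have e9 : (1 - sigma) / (2 * lam) * ‖yt - p‖ ^ 2 = ‖yt - p‖ ^ 2 / (2 * lam)
      - sigma / (2 * lam) * ‖yt - p‖ ^ 2 := by ring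
    linarith
  have h7' := mul_le_mul_of_nonneg_left h7 hBp0.le
  have h8 := mul_le_mul_of_nonneg_left hPy hB
  have h9 := mul_le_mul_of_nonneg_left hPw hb.le
  generalize gamq (G - ‖z - p‖ ^ 2 / (2 * lam)) mu u z = g at *
  have h8' : B * g y ≤ B * Py := by linarith
  have h9' : b * g w ≤ b * Pw := by linarith
  rw [mul_sub, mul_add] at h7'
  have : Bp * Pw = B * Pw + b * Pw := by rw [hBp]; ring
  rw [mul_sub, mul_sub]
  linarith

lemma aux_summable (lam mu alpha : ℝ) (hlam : 0 < lam) (hmu : 0 ≤ mu) (halpha0 : 0 ≤ alpha)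
    (halpha1 : alpha < ((1 + Real.sqrt (lam * mu)) ^ 2)⁻¹) (B b tau : ℕ → ℝ)
    (hB : ∀ k, 0 ≤ B k) (hB0 : B 0 = 0) (hb : ∀ k, 0 ≤ b k)
    (hBrec : ∀ k, B (k + 1) = B k + b k)
    (htau : ∀ k, tau k = 1 + mu * B k)
    (hb2 : ∀ k, b k ^ 2 = lam * tau k * B (k + 1)) :
    Summable (fun i => B (i + 1) * alpha ^ i) := by
  set q := 1 + Real.sqrt (lam * mu) with hq
  have hq1 : 1 ≤ q := by have := Real.sqrt_nonneg (lam * mu); linarith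
  have hs : ∀ k, Real.sqrt (B (k + 1)) ≤ q * Real.sqrt (B k) + Real.sqrt lam := by
    intro k
    have h1 := Real.sq_sqrt (hB k)
    have h2 := Real.sq_sqrt (hB (k + 1))
    have h3 := Real.sq_sqrt hlam.le
    have h4 := Real.sq_sqrt (mul_nonneg hlam.le hmu)
    have e : q = 1 + Real.sqrt (lam * mu) := rfl
    have p0 := Real.sqrt_nonneg (B k)
    have p1 := Real.sqrt_nonneg (B (k + 1))
    have p2 := Real.sqrt_nonneg lam
    have p3 := Real.sqrt_nonneg (lam * mu)
    have hb' : b k ≤ (Real.sqrt lam + Real.sqrt (lam * mu) * Real.sqrt (B k))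
        * Real.sqrt (B (k + 1)) := by
      apply abs_le_of_sq_le_sq' _ (by positivity) |>.2
      rw [hb2, htau, mul_pow, h2]
      apply mul_le_mul_of_nonneg_right _ (hB _)
      have : (Real.sqrt lam + Real.sqrt (lam * mu) * Real.sqrt (B k)) ^ 2
        = lam * (1 + mu * B k) + 2 * (Real.sqrt lam * (Real.sqrt (lam * mu) * Real.sqrt (B k))) := by
        rw [add_sq, mul_pow, h1, h3, h4]; ring
      rw [this]
      have : 0 ≤ Real.sqrt lam * (Real.sqrt (lam * mu) * Real.sqrt (B k)) := by positivity
      linarith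
    rw [e]
    generalize Real.sqrt (B k) = r at *
    generalize Real.sqrt (B (k + 1)) = s at *
    generalize Real.sqrt lam = l at *
    generalize Real.sqrt (lam * mu) = v at *
    have h5 : s ^ 2 - r ^ 2 ≤ (l + v * r) * s := by rw [h2, h1, hBrec]; linarith
    by_contra hc
    push Not at hc
    have : 0 ≤ l + v * r := by positivity
    nlinarith
  have hbd : ∀ k : ℕ, Real.sqrt (B k) ≤ k * (Real.sqrt lam * q ^ k) := by
    intro k
    induction k with
    | zero => simp [hB0]
    | succ k ih =>
      have h1 := mul_le_mul_of_nonneg_left ih (by linarith : 0 ≤ q)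
      have h2 : Real.sqrt lam * 1 ≤ Real.sqrt lam * q ^ (k + 1) :=
        mul_le_mul_of_nonneg_left (one_le_pow₀ hq1) (Real.sqrt_nonneg _)
      have h3 : q * (k * (Real.sqrt lam * q ^ k)) = k * (Real.sqrt lam * q ^ (k + 1)) := by ring
      push_cast
      linarith [hs k]
  have hr : ‖q ^ 2 * alpha‖ < 1 := by
    rw [Real.norm_of_nonneg (by positivity)]
    have hq2 : 0 < q ^ 2 := by positivity
    calc q ^ 2 * alpha < q ^ 2 * (q ^ 2)⁻¹ := mul_lt_mul_of_pos_left halpha1 hq2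
      _ = 1 := mul_inv_cancel₀ hq2.ne'
  have g0 := summable_pow_mul_geometric_of_norm_lt_one 0 hr
  have g1 := summable_pow_mul_geometric_of_norm_lt_one 1 hr
  have g2 := summable_pow_mul_geometric_of_norm_lt_one 2 hr
  have g := ((g2.add (g1.mul_left 2)).add g0).mul_left (lam * q ^ 2)
  refine Summable.of_nonneg_of_le (fun i => mul_nonneg (hB _) (by positivity)) (fun i => ?_) g
  have h1 : B (i + 1) ≤ ((i + 1 : ℕ) * (Real.sqrt lam * q ^ (i + 1))) ^ 2 := by
    rw [← Real.sq_sqrt (hB (i + 1))]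
    exact pow_le_pow_left₀ (Real.sqrt_nonneg _) (hbd (i + 1)) 2
  calc B (i + 1) * alpha ^ i ≤ ((i + 1 : ℕ) * (Real.sqrt lam * q ^ (i + 1))) ^ 2 * alpha ^ i :=
        mul_le_mul_of_nonneg_right h1 (by positivity)
    _ = _ := by
      rw [mul_pow, mul_pow, Real.sq_sqrt hlam.le, mul_pow (q ^ 2)]
      push_cast
      ring

theorem flora_prox_center_distance_bound
    (domPhi : Set (Euc n)) (Phi : Euc n → ℝ) (Gam : ℕ → Euc n → ℝ)
    (sigma lam mu delta0 alpha : ℝ)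
    (hsigma0 : 0 < sigma) (hsigma1 : sigma < 1) (hlam : 0 < lam) (hmu : 0 ≤ mu)
    (hdelta0 : 0 ≤ delta0)
    (halpha0 : 0 ≤ alpha) (halpha1 : alpha < ((1 + Real.sqrt (lam * mu)) ^ 2)⁻¹)
    (hPhiconv : ConvexOn ℝ domPhi Phi)
    (hPhilsc : LowerSemicontinuousOn Phi domPhi)
    (hPhisc : SCOn domPhi mu Phi)
    (b B tau : ℕ → ℝ) (x y xt yt z uhat u : ℕ → Euc n)
    (hB0 : B 0 = 0) (htau0 : tau 0 = 1) (hy0 : y 0 = x 0) (hx0 : x 0 ∈ domPhi)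
    (hx0zero : x 0 = 0)
    (hb : ∀ k, b k = (lam * tau k +
        Real.sqrt (lam ^ 2 * tau k ^ 2 + 4 * lam * tau k * B k)) / 2)
    (hBrec : ∀ k, B (k + 1) = B k + b k)
    (htaurec : ∀ k, tau (k + 1) = tau k + b k * mu)
    (hxt : ∀ k, xt k = (B k / B (k + 1)) • y k + (b k / B (k + 1)) • x k)
    (hGamsc : ∀ k, SCOn domPhi (mu + 1 / lam) (Gam k))
    (hGamle : ∀ k, ∀ w ∈ domPhi, Gam k w ≤ Phi w + ‖w - xt k‖ ^ 2 / (2 * lam))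
    (hytmem : ∀ k, yt (k + 1) ∈ domPhi) (hzmem : ∀ k, z (k + 1) ∈ domPhi)
    (hz : ∀ k, (∃ 𝒜 : ℝ, 0 < 𝒜 ∧
            (∀ w ∈ domPhi, Gam k (z (k + 1)) + ‖z (k + 1) - xt k‖ ^ 2 / (2 * 𝒜) ≤
              Gam k w + ‖w - xt k‖ ^ 2 / (2 * 𝒜)) ∧
            uhat (k + 1) = 𝒜⁻¹ • (xt k - z (k + 1))) ∨
          ((∀ w ∈ domPhi, Gam k (z (k + 1)) ≤ Gam k w) ∧ uhat (k + 1) = 0))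
    (hineq : ∀ k,
        ‖lam • uhat (k + 1)‖ ^ 2 +
          2 * lam * (Phi (yt (k + 1)) + ‖yt (k + 1) - xt k‖ ^ 2 / (2 * lam) -
            Gam k (z (k + 1))) ≤
        sigma * ‖yt (k + 1) - xt k‖ ^ 2 + 2 * lam * (delta0 * alpha ^ k))
    -- `y_k = ỹ_k` at every iteration
    (hyeq : ∀ k, y (k + 1) = yt (k + 1))
    (hu : ∀ k, u (k + 1) = uhat (k + 1) + lam⁻¹ • (xt k - z (k + 1)))
    (hxrec : ∀ k, x (k + 1) = (tau (k + 1))⁻¹ •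
        (tau k • x k + (b k * mu) • z (k + 1) - b k • u (k + 1)))
    -- `xstar` attains the minimum distance `R0` from `x 0` to the solution set
    (xstar : Euc n) (R0 : ℝ)
    (hxstar : xstar ∈ domPhi) (hxstarmin : ∀ w ∈ domPhi, Phi xstar ≤ Phi w)
    (hR0 : R0 = ‖x 0 - xstar‖)
    (hR0min : ∀ w ∈ domPhi, (∀ v ∈ domPhi, Phi w ≤ Phi v) → R0 ≤ ‖x 0 - w‖) :
    ∀ k : ℕ,
      ‖xt k - xstar‖ ≤
        max 1 R0 *
          (1 + Real.sqrt (2 * delta0 * ∑' i : ℕ, B (i + 1) * alpha ^ i)) *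
          (2 / Real.sqrt (1 - sigma) + 1) := by
  have htau : ∀ k, tau k = 1 + mu * B k := by
    intro k
    induction k with
    | zero => simp [htau0, hB0]
    | succ k ih => rw [htaurec, hBrec, ih]; ring
  have hB : ∀ k, 0 ≤ B k := by
    intro k
    induction k with
    | zero => simp [hB0]
    | succ k ih =>
      rw [hBrec, hb, htau]
      have := Real.sqrt_nonneg (lam ^ 2 * (1 + mu * B k) ^ 2 + 4 * lam * (1 + mu * B k) * B k)
      positivity
  have htau1 : ∀ k, 1 ≤ tau k := by
    intro k; rw [htau]; have := mul_nonneg hmu (hB k); linarith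
  have hblam : ∀ k, lam ≤ b k := by
    intro k
    have h1 : lam * tau k ≤ Real.sqrt (lam ^ 2 * tau k ^ 2 + 4 * lam * tau k * B k) := by
      apply Real.le_sqrt_of_sq_le
      have : 0 ≤ 4 * lam * tau k * B k := by
        have := htau1 k; have := hB k; positivity
      nlinarith
    rw [hb]
    nlinarith [htau1 k]
  have hb0 : ∀ k, 0 < b k := fun k => lt_of_lt_of_le hlam (hblam k)
  have hBpos : ∀ k, 0 < B (k + 1) := by
    intro k; rw [hBrec]; linarith [hB k, hb0 k]
  have hb2 : ∀ k, b k ^ 2 = lam * tau k * B (k + 1) := by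
    intro k
    have h1 : 0 ≤ lam ^ 2 * tau k ^ 2 + 4 * lam * tau k * B k := by
      have := htau1 k; have := hB k; positivity
    have h2 := Real.sq_sqrt h1
    have h3 := hb k
    rw [hBrec]
    generalize Real.sqrt (lam ^ 2 * tau k ^ 2 + 4 * lam * tau k * B k) = s at *
    have h4 : s = 2 * b k - lam * tau k := by linarith
    rw [h4] at h2
    linarith
  have hsum := aux_summable lam mu alpha hlam hmu halpha0 halpha1 B b tau hB hB0
    (fun k => (hb0 k).le) hBrec htau hb2
  have hnn : ∀ i, 0 ≤ B (i + 1) * alpha ^ i := fun i => mul_nonneg (hB _) (by positivity)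
  set C := ∑' i : ℕ, B (i + 1) * alpha ^ i with hC
  have hC0 : 0 ≤ C := tsum_nonneg hnn
  have hymem : ∀ k, y k ∈ domPhi := by
    intro k
    cases k with
    | zero => rw [hy0]; exact hx0
    | succ k => rw [hyeq]; exact hytmem k
  have hsub : ∀ k, ∀ w ∈ domPhi, Gam k (z (k + 1)) + ⟪uhat (k + 1), w - z (k + 1)⟫
      + (mu + 1 / lam) / 2 * ‖w - z (k + 1)‖ ^ 2 ≤ Phi w + ‖w - xt k‖ ^ 2 / (2 * lam) := by
    intro k w hw
    refine le_trans ?_ (hGamle k w hw)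
    rcases hz k with ⟨A, hA, hmin, hue⟩ | ⟨hmin, hue⟩
    · have := aux_min domPhi hPhiconv.1 (Gam k) _ (1 / (2 * A)) (hGamsc k) (z (k + 1)) (xt k)
        (hzmem k) (fun w hw => by
          have := hmin w hw
          rw [div_mul_eq_mul_div, one_mul, div_mul_eq_mul_div, one_mul]
          exact this) w hw
      rw [hue, inner_smul_left]
      simp only [RCLike.conj_to_real]
      have e : 2 * (1 / (2 * A)) = A⁻¹ := by field_simp
      rw [e] at this
      exact this
    · have := aux_min domPhi hPhiconv.1 (Gam k) _ 0 (hGamsc k) (z (k + 1)) (xt k)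
        (hzmem k) (fun w hw => by simpa using hmin w hw) w hw
      rw [hue, inner_zero_left]
      simpa using this
  have hstep : ∀ k, B (k + 1) * (Phi (y (k + 1)) - Phi xstar)
      + tau (k + 1) / 2 * ‖xstar - x (k + 1)‖ ^ 2
      + B (k + 1) * ((1 - sigma) / (2 * lam) * ‖y (k + 1) - xt k‖ ^ 2) ≤
      B k * (Phi (y k) - Phi xstar) + tau k / 2 * ‖xstar - x k‖ ^ 2
      + B (k + 1) * (delta0 * alpha ^ k) := by
    intro k
    rw [htaurec, hyeq k]
    refine aux_step_s19 lam mu sigma (Gam k (z (k + 1))) (delta0 * alpha ^ k) (b k) (B k) (B (k + 1))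
      (tau k) _ _ _ hlam hmu (uhat (k + 1)) (u (k + 1)) (z (k + 1)) (xt k) xstar (x k) (x (k + 1))
      (y k) (yt (k + 1)) (hb0 k) (hB k) (hBrec k) (hb2 k) (hu k) (hxt k) ?_ (hsub k _ (hymem k))
      (hsub k _ hxstar) (hineq k)
    rw [hxrec, ← htaurec, smul_smul, mul_inv_cancel₀ (by linarith [htau1 (k + 1)]), one_smul]
  set D2 := R0 ^ 2 + 2 * delta0 * C with hD2
  have hD20 : 0 ≤ D2 := by positivity
  have hpot : ∀ k, B k * (Phi (y k) - Phi xstar) + tau k / 2 * ‖xstar - x k‖ ^ 2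
      + (1 - sigma) / (2 * lam) * ∑ i ∈ Finset.range k, B (i + 1) * ‖y (i + 1) - xt i‖ ^ 2
      ≤ R0 ^ 2 / 2 + delta0 * ∑ i ∈ Finset.range k, B (i + 1) * alpha ^ i := by
    intro k
    induction k with
    | zero => simp [hB0, htau0, hR0, norm_sub_rev xstar]; linarith
    | succ k ih =>
      rw [Finset.sum_range_succ, Finset.sum_range_succ, mul_add, mul_add]
      have := hstep k
      have e1 : B (k + 1) * ((1 - sigma) / (2 * lam) * ‖y (k + 1) - xt k‖ ^ 2)
        = (1 - sigma) / (2 * lam) * (B (k + 1) * ‖y (k + 1) - xt k‖ ^ 2) := by ring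
      have e2 : B (k + 1) * (delta0 * alpha ^ k) = delta0 * (B (k + 1) * alpha ^ k) := by ring
      linarith
  have hpot2 : ∀ k, B k * (Phi (y k) - Phi xstar) + tau k / 2 * ‖xstar - x k‖ ^ 2
      + (1 - sigma) / (2 * lam) * ∑ i ∈ Finset.range k, B (i + 1) * ‖y (i + 1) - xt i‖ ^ 2
      ≤ D2 / 2 := by
    intro k
    have h1 : ∑ i ∈ Finset.range k, B (i + 1) * alpha ^ i ≤ C :=
      hsum.sum_le_tsum _ (fun i _ => hnn i)
    have h2 := mul_le_mul_of_nonneg_left h1 hdelta0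
    have := hpot k
    rw [hD2]; linarith
  have hgap : ∀ k, 0 ≤ B k * (Phi (y k) - Phi xstar) := fun k =>
    mul_nonneg (hB k) (sub_nonneg.2 (hxstarmin _ (hymem k)))
  have hs1 : 0 < 1 - sigma := by linarith
  have hSnn : ∀ k, 0 ≤ ∑ i ∈ Finset.range k, B (i + 1) * ‖y (i + 1) - xt i‖ ^ 2 := fun k =>
    Finset.sum_nonneg (fun i _ => mul_nonneg (hB _) (by positivity))
  set D := Real.sqrt D2 with hD
  have hD0 : 0 ≤ D := Real.sqrt_nonneg _
  have hDsq : D ^ 2 = D2 := Real.sq_sqrt hD20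
  have hxD : ∀ k, ‖x k - xstar‖ ≤ D := by
    intro k
    apply Real.le_sqrt_of_sq_le
    have h1 := hpot2 k
    have h2 := hgap k
    have h3 : 0 ≤ (1 - sigma) / (2 * lam) *
        ∑ i ∈ Finset.range k, B (i + 1) * ‖y (i + 1) - xt i‖ ^ 2 :=
      mul_nonneg (by positivity) (hSnn k)
    rw [norm_sub_rev]
    nlinarith [htau1 k, sq_nonneg ‖xstar - x k‖]
  have hSD : ∀ k, (1 - sigma) * ∑ i ∈ Finset.range k, B (i + 1) * ‖y (i + 1) - xt i‖ ^ 2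
      ≤ lam * D ^ 2 := by
    intro k
    have h1 := hpot2 k
    have h2 := hgap k
    have h3 : 0 ≤ tau k / 2 * ‖xstar - x k‖ ^ 2 := by have := htau1 k; positivity
    have h4 : (1 - sigma) / (2 * lam) *
        ∑ i ∈ Finset.range k, B (i + 1) * ‖y (i + 1) - xt i‖ ^ 2 ≤ D2 / 2 := by linarith
    rw [div_mul_eq_mul_div, div_le_iff₀ (by positivity)] at h4
    rw [hDsq]; linarith
  have hBs : ∀ k, lam * ∑ i ∈ Finset.range k, B (i + 1) ≤ B k ^ 2 := by
    intro k
    induction k with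
    | zero => simp [hB0]
    | succ k ih =>
      rw [Finset.sum_range_succ, mul_add]
      have h1 := mul_le_mul_of_nonneg_right (hblam k) (hBpos k).le
      have h2 := hBrec k
      have h3 := mul_nonneg (hB k) (hb0 k).le
      have h4 : B (k + 1) ^ 2 = B k ^ 2 + b k * B (k + 1) + B k * b k := by rw [h2]; ring
      linarith
  set r := Real.sqrt (1 - sigma) with hr
  have hr0 : 0 < r := Real.sqrt_pos.2 hs1
  have hrsq : r ^ 2 = 1 - sigma := Real.sq_sqrt hs1.le
  have hT : ∀ k, ∑ i ∈ Finset.range k, B (i + 1) * ‖y (i + 1) - xt i‖ ≤ B k * (D / r) := by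
    intro k
    have hcs : (∑ i ∈ Finset.range k, B (i + 1) * ‖y (i + 1) - xt i‖) ^ 2 ≤
        (∑ i ∈ Finset.range k, B (i + 1)) *
          ∑ i ∈ Finset.range k, B (i + 1) * ‖y (i + 1) - xt i‖ ^ 2 := by
      apply Finset.sum_sq_le_sum_mul_sum_of_sq_eq_mul
      · intro i _; exact hB _
      · intro i _; exact mul_nonneg (hB _) (by positivity)
      · intro i _; ring
    apply abs_le_of_sq_le_sq' _ (mul_nonneg (hB k) (by positivity)) |>.2
    have h1 := hSD k
    have h2 := hBs k
    have h3 := hSnn k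
    have h5 : 0 ≤ ∑ i ∈ Finset.range k, B (i + 1) := Finset.sum_nonneg (fun i _ => hB _)
    rw [mul_pow, div_pow, hrsq]
    refine hcs.trans ?_
    rw [← mul_div_assoc, le_div_iff₀ hs1]
    generalize (∑ i ∈ Finset.range k, B (i + 1)) = S1 at *
    generalize (∑ i ∈ Finset.range k, B (i + 1) * ‖y (i + 1) - xt i‖ ^ 2) = S2 at *
    calc S1 * S2 * (1 - sigma) = S1 * ((1 - sigma) * S2) := by ring
      _ ≤ S1 * (lam * D ^ 2) := mul_le_mul_of_nonneg_left h1 h5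
      _ = (lam * S1) * D ^ 2 := by ring
      _ ≤ _ := mul_le_mul_of_nonneg_right h2 (by positivity)
  have hxtb : ∀ k, B (k + 1) * ‖xt k - xstar‖ ≤ B k * ‖y k - xstar‖ + b k * D := by
    intro k
    have e : B (k + 1) • (xt k - xstar) = B k • (y k - xstar) + b k • (x k - xstar) := by
      have h0 := (hBpos k).ne'
      rw [hxt, smul_sub, smul_add, smul_smul, smul_smul, mul_div_cancel₀ _ h0,
        mul_div_cancel₀ _ h0]
      nth_rewrite 1 [hBrec]
      module
    calc B (k + 1) * ‖xt k - xstar‖ = ‖B (k + 1) • (xt k - xstar)‖ := by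
          rw [norm_smul, Real.norm_of_nonneg (hB _)]
      _ ≤ ‖B k • (y k - xstar)‖ + ‖b k • (x k - xstar)‖ := by rw [e]; exact norm_add_le _ _
      _ = B k * ‖y k - xstar‖ + b k * ‖x k - xstar‖ := by
          rw [norm_smul, norm_smul, Real.norm_of_nonneg (hB _), Real.norm_of_nonneg (hb0 k).le]
      _ ≤ _ := by have := mul_le_mul_of_nonneg_left (hxD k) (hb0 k).le; linarith
  have hyb : ∀ k, B k * ‖y k - xstar‖ ≤ B k * D +
      ∑ i ∈ Finset.range k, B (i + 1) * ‖y (i + 1) - xt i‖ := by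
    intro k
    induction k with
    | zero => simp [hB0]
    | succ k ih =>
      rw [Finset.sum_range_succ]
      have h1 : ‖y (k + 1) - xstar‖ ≤ ‖y (k + 1) - xt k‖ + ‖xt k - xstar‖ :=
        norm_sub_le_norm_sub_add_norm_sub _ _ _
      have h2 := mul_le_mul_of_nonneg_left h1 (hB (k + 1))
      have h3 := hxtb k
      have h4 : B (k + 1) * D = B k * D + b k * D := by rw [hBrec]; ring
      rw [mul_add] at h2
      linarith
  intro k
  have hfin : ‖xt k - xstar‖ ≤ D * (1 / r + 1) := by
    have h1 := hxtb k
    have h2 := hyb k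
    have h3 := hT k
    have h4 : B (k + 1) * (D * (1 / r + 1)) = B k * D + B k * (D / r) + b k * D + b k * (D / r) := by
      rw [hBrec]; ring
    have h5 : 0 ≤ b k * (D / r) := mul_nonneg (hb0 k).le (by positivity)
    exact le_of_mul_le_mul_left (by linarith) (hBpos k)
  have hR00 : 0 ≤ R0 := by rw [hR0]; exact norm_nonneg _
  have hDle : D ≤ max 1 R0 * (1 + Real.sqrt (2 * delta0 * C)) := by
    have h0 : 0 ≤ 2 * delta0 * C := by positivity
    have h1 := Real.sq_sqrt h0
    have h2 := Real.sqrt_nonneg (2 * delta0 * C)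
    have h3 : D ≤ R0 + Real.sqrt (2 * delta0 * C) := by
      apply Real.sqrt_le_iff.2 ⟨by positivity, ?_⟩
      rw [add_sq, h1]
      have : 0 ≤ 2 * R0 * Real.sqrt (2 * delta0 * C) := by positivity
      linarith
    have h4 := le_max_left 1 R0
    have h5 := le_max_right 1 R0
    nlinarith
  refine hfin.trans ?_
  have h1 : (1 : ℝ) / r ≤ 2 / r := by gcongr; norm_num
  apply mul_le_mul hDle (by linarith) (by positivity) (hD0.trans hDle)
end
end
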